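/- arXiv:2405.12170 — 4 statements merged into one kernel-verified Lean document; each statement's English description precedes it below -/
import Mathlib

section
/- Let S be a commutative ring, let 𝔞 and I be ideals of S, and let S[t] be the polynomial ring over S in one indeterminate t. Then (𝔞S[t] + (t)) :_{S[t]} (IS[t] + (t)) = (𝔞 :_S I)S[t] + (t), where 𝔞S[t] and IS[t] denote the extensions of 𝔞 and I to S[t]. -/
/-- A polynomial lies in `J S[t] + (t)` if and only if its constant coefficient lies in `J`. -/
theorem Ideal.mem_map_C_sup_span_X_iff {S : Type*} [CommRing S] {J : Ideal S}
    {p : Polynomial S} :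
    p ∈ J.map (Polynomial.C : S →+* Polynomial S) ⊔ Ideal.span {(Polynomial.X : Polynomial S)} ↔
      p.coeff 0 ∈ J := by
  constructor
  · intro hp
    obtain ⟨a, ha, b, hb, rfl⟩ := Submodule.mem_sup.1 hp
    rw [Polynomial.coeff_add, Polynomial.X_dvd_iff.1 (Ideal.mem_span_singleton.1 hb), add_zero]
    exact Ideal.mem_map_C_iff.1 ha 0
  · intro hp
    rw [← Polynomial.divX_mul_X_add p]
    exact Ideal.add_mem _
      (Ideal.mem_sup_right (Ideal.mul_mem_left _ _ (Ideal.mem_span_singleton_self _)))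
      (Ideal.mem_sup_left (Ideal.mem_map_of_mem _ hp))

/-- Let `S` be a commutative ring, `𝔞` and `I` ideals of `S`, and `S[t]` the polynomial
ring in one indeterminate `t` over `S`.  Then
`(𝔞S[t] + (t)) :_{S[t]} (IS[t] + (t)) = (𝔞 :_S I)S[t] + (t)`. -/
theorem statement5 {S : Type*} [CommRing S] (𝔞 I : Ideal S) :
    Submodule.colon
        (𝔞.map (Polynomial.C : S →+* Polynomial S) ⊔
          Ideal.span {(Polynomial.X : Polynomial S)})
        (I.map (Polynomial.C : S →+* Polynomial S) ⊔
          Ideal.span {(Polynomial.X : Polynomial S)}) =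
      (Submodule.colon 𝔞 I).map (Polynomial.C : S →+* Polynomial S) ⊔
        Ideal.span {(Polynomial.X : Polynomial S)} := by
  ext p
  simp only [Submodule.mem_colon, SetLike.mem_coe, Ideal.mem_map_C_sup_span_X_iff, smul_eq_mul,
    Polynomial.mul_coeff_zero]
  refine ⟨fun h s hs ↦ ?_, fun h q hq ↦ h _ (Ideal.mem_map_C_sup_span_X_iff.1 ?_)⟩
  · simpa using h (Polynomial.C s) (Or.inl (Ideal.mem_map_of_mem _ hs))
  · exact hq.elim (fun hq ↦ Ideal.mem_sup_left hq) (fun hq ↦ Ideal.mem_sup_right hq)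
end

section
/- Let (R, 𝔪) be a Noetherian local commutative ring that is formally equidimensional, i.e., the 𝔪-adic completion R̂ of R is equidimensional (dim(R̂/𝔭) = dim(R̂) for every minimal prime 𝔭 of R̂). Let I = (f_1, …, f_r) be an ideal of R that is not nilpotent, let s be an integer with s ≥ max{1, ht(I)}, let S = R[U_{ij} : 1 ≤ i ≤ r, 1 ≤ j ≤ s] be the polynomial ring over R in rs indeterminates, and set a'_j = Σ_{i=1}^r U_{ij} f_i for 1 ≤ j ≤ s. Then the generic s-residual R(s, f) = (a'_1, …, a'_s) :_S IS satisfies ht(R(s, f)) ≤ s. -/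
open MvPolynomial

/-- The height of an ideal: the infimum of the heights (in the prime spectrum, ordered by
inclusion) of the prime ideals containing it. -/
noncomputable def idealHeight {A : Type*} [CommRing A] (I : Ideal A) : ℕ∞ :=
  ⨅ (p : PrimeSpectrum A) (_ : I ≤ p.asIdeal), Order.height p

/-- The height of an ideal is at most the height of any prime ideal containing it. -/
theorem idealHeight_le_height {A : Type*} [CommRing A] {I P : Ideal A} [hP : P.IsPrime]
    (h : I ≤ P) : idealHeight I ≤ P.height :=
  (iInf₂_le (⟨P, hP⟩ : PrimeSpectrum A) h).trans_eq
    (PrimeSpectrum.height_eq_orderHeight ⟨P, hP⟩).symm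

/-- Krull's height theorem for an ideal generated by a family of `n` elements. -/
theorem height_le_of_mem_minimalPrimes_span_range {A : Type*} [CommRing A] [IsNoetherianRing A]
    {n : ℕ} (g : Fin n → A) {P : Ideal A} (hP : P ∈ (Ideal.span (Set.range g)).minimalPrimes) :
    P.height ≤ n := by
  refine (Ideal.height_le_spanRank_toENat_of_mem_minimalPrimes _ P hP).trans ?_
  refine (Cardinal.toENat.monotone' (Submodule.spanRank_span_le_card _)).trans ?_
  change (Set.range g).encard ≤ n
  rw [← Set.image_univ]
  refine (Set.encard_image_le _ _).trans ?_
  simp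

/-- **Proposition 4.2.** Let `(R, 𝔪)` be a Noetherian local ring that is formally
equidimensional (its `𝔪`-adic completion `R̂` is equidimensional).  Let
`I = (f₁, …, f_r)` be an ideal of `R` that is not nilpotent, let `s ≥ max {1, ht I}`,
let `S = R[U_{ij}]` be the polynomial ring in `rs` indeterminates and
`a'_j = Σᵢ U_{ij} fᵢ`.  Then the generic `s`-residual
`R(s, f) = (a'₁, …, a'_s) :_S IS` satisfies `ht R(s, f) ≤ s`. -/
theorem statement7 {R : Type*} [CommRing R] [IsNoetherianRing R] [IsLocalRing R]
    (hfe : ∀ p ∈ minimalPrimes (AdicCompletion (IsLocalRing.maximalIdeal R) R),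
      ringKrullDim ((AdicCompletion (IsLocalRing.maximalIdeal R) R) ⧸ p) =
        ringKrullDim (AdicCompletion (IsLocalRing.maximalIdeal R) R))
    {r : ℕ} (f : Fin r → R)
    (hnotnil : ¬ IsNilpotent (Ideal.span (Set.range f)))
    (s : ℕ) (hs : max 1 (idealHeight (Ideal.span (Set.range f))) ≤ (s : ℕ∞)) :
    idealHeight
      (Submodule.colon
        (Ideal.span (Set.range fun j : Fin s =>
          ∑ i : Fin r, (X (i, j) : MvPolynomial (Fin r × Fin s) R) * C (f i)))
        ((Ideal.span (Set.range f)).map (C : R →+* MvPolynomial (Fin r × Fin s) R)))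
      ≤ (s : ℕ∞) := by
  set J : Ideal (MvPolynomial (Fin r × Fin s) R) :=
    Ideal.span (Set.range fun j : Fin s =>
      ∑ i : Fin r, (X (i, j) : MvPolynomial (Fin r × Fin s) R) * C (f i))
  obtain ⟨i, hi⟩ : ∃ i, ¬ IsNilpotent (f i) := by
    by_contra! h
    refine hnotnil ((IsNoetherianRing.isNilpotent_nilradical R).imp fun n hn => ?_)
    rw [Submodule.zero_eq_bot, eq_bot_iff] at hn ⊢
    refine (Ideal.pow_right_mono (Ideal.span_le.2 ?_) n).trans hn
    rintro _ ⟨i, rfl⟩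
    exact h i
  obtain ⟨p, hp, hfp⟩ : ∃ p : Ideal R, p.IsPrime ∧ f i ∉ p := by
    by_contra! h
    exact hi (nilpotent_iff_mem_prime.2 h)
  let φ : MvPolynomial (Fin r × Fin s) R →+* R := eval fun _ => 0
  have hJp : J ≤ p.comap φ := by
    refine Ideal.span_le.2 ?_
    rintro _ ⟨j, rfl⟩
    simp [φ]
  obtain ⟨P, hP, hPle⟩ := Ideal.exists_minimalPrimes_le hJp
  have hPp : P.IsPrime := hP.1.1
  have hfP : C (f i) ∉ P := fun h => hfp (by simpa [φ] using hPle h)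
  have hcol : Submodule.colon J
      ((Ideal.span (Set.range f)).map (C : R →+* MvPolynomial (Fin r × Fin s) R)) ≤ P := by
    intro x hx
    have hmem := Submodule.mem_colon.1 hx (C (f i))
      (Ideal.mem_map_of_mem _ (Ideal.subset_span ⟨i, rfl⟩))
    exact (hPp.mem_or_mem (hP.1.2 hmem)).resolve_right hfP
  exact (idealHeight_le_height hcol).trans (height_le_of_mem_minimalPrimes_span_range _ hP)
end

section
/- Let (R, 𝔪) be a Cohen–Macaulay Noetherian local ring, let 𝔞 = (a_1, …, a_s) ⊆ I = (f_1, …, f_r) be ideals of R, and suppose J = 𝔞 :_R I is an s-residual intersection of I, i.e., J is a proper ideal with ht(J) ≥ s. Choose c_{ij} ∈ R with a_j = Σ_{i=1}^r c_{ij} f_i, let S = R[U_{ij} : 1 ≤ i ≤ r, 1 ≤ j ≤ s] be the polynomial ring over R in rs indeterminates, set a'_j = Σ_{i=1}^r U_{ij} f_i, R(s, f) = (a'_1, …, a'_s) :_S IS, and let x denote the sequence U_{11} − c_{11}, …, U_{rs} − c_{rs} in S. Then for every maximal ideal 𝔫 of S containing R(s, f) + (x), the extension R(s, f)·S_𝔫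 to the localization S_𝔫 has height at least s; in particular R(s, f)·S_𝔫 = (a'_1, …, a'_s)S_𝔫 :_{S_𝔫} IS_𝔫 is an s-residual intersection of IS_𝔫. -/
open MvPolynomial

/-- The depth of a local ring: the supremum of the lengths of regular sequences
consisting of elements of the maximal ideal. -/
noncomputable def ringDepth (R : Type*) [CommRing R] [IsLocalRing R] : ℕ∞ :=
  ⨆ (rs : List R) (_ : ∀ x ∈ rs, x ∈ IsLocalRing.maximalIdeal R)
    (_ : RingTheory.Sequence.IsRegular R rs), (rs.length : ℕ∞)

/-- A Noetherian local ring is Cohen–Macaulay if `depth R = dim R`. -/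
def IsCohenMacaulayLocalRing (R : Type*) [CommRing R] [IsLocalRing R] : Prop :=
  (ringDepth R : WithBot ℕ∞) = ringKrullDim R

/-- The generic `s`-residual `R(s, f) = (a'₁, …, a'_s) :_S IS` of the generating set
`f = f₁, …, f_r` of `I`, where `S = R[U_{ij}]` and `a'_j = Σᵢ U_{ij} fᵢ`. -/
noncomputable def genericResidual {R : Type*} [CommRing R] (r s : ℕ) (f : Fin r → R) :
    Ideal (MvPolynomial (Fin r × Fin s) R) :=
  Submodule.colon
    (Ideal.span (Set.range fun j : Fin s =>
      ∑ i : Fin r, (X (i, j) : MvPolynomial (Fin r × Fin s) R) * C (f i)))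
    ((Ideal.span (Set.range f)).map (C : R →+* MvPolynomial (Fin r × Fin s) R))

/-- Multiplication by `x` is injective on `A ⧸ I`. -/
def IsRegularModulo {A : Type*} [CommRing A] (I : Ideal A) (x : A) : Prop :=
  ∀ a, x * a ∈ I → a ∈ I

/-- There are `x₁, …, xₙ ∈ J` such that each `xᵢ` is regular modulo `I + (x₁, …, xᵢ₋₁)`. -/
inductive HasWeaklyRegularSeq {A : Type*} [CommRing A] (J : Ideal A) : ℕ → Ideal A → Prop
  | zero (I : Ideal A) : HasWeaklyRegularSeq J 0 I
  | succ (n : ℕ) (I : Ideal A) (x : A) (hx : x ∈ J) (hreg : IsRegularModulo I x)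
      (h : HasWeaklyRegularSeq J n (I ⊔ Ideal.span {x})) : HasWeaklyRegularSeq J (n + 1) I

theorem mem_sup_span_singleton_iff {A : Type*} [CommRing A] {I : Ideal A} {x a : A} :
    a ∈ I ⊔ Ideal.span {x} ↔ ∃ c, a - x * c ∈ I := by
  rw [Submodule.mem_sup]
  constructor
  · rintro ⟨i, hi, y, hy, rfl⟩
    obtain ⟨c, rfl⟩ := Ideal.mem_span_singleton'.1 hy
    exact ⟨c, by simpa [mul_comm] using hi⟩
  · rintro ⟨c, hc⟩
    exact ⟨_, hc, x * c, Ideal.mem_span_singleton'.2 ⟨c, mul_comm _ _⟩, by ring⟩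

/-- Two consecutive elements of a regular sequence: the first stays regular modulo the second. -/
theorem IsRegularModulo.swap {A : Type*} [CommRing A] {I : Ideal A} {x z : A}
    (hx : IsRegularModulo I x) (hz : IsRegularModulo (I ⊔ Ideal.span {x}) z) :
    IsRegularModulo (I ⊔ Ideal.span {z}) x := by
  intro a ha
  obtain ⟨b, hb⟩ := mem_sup_span_singleton_iff.1 ha
  have hzb : z * b ∈ I ⊔ Ideal.span {x} := by
    refine mem_sup_span_singleton_iff.2 ⟨a, ?_⟩
    simpa using I.neg_mem hb
  obtain ⟨c, hc⟩ := mem_sup_span_singleton_iff.1 (hz b hzb)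
  refine mem_sup_span_singleton_iff.2 ⟨c, hx _ ?_⟩
  have : x * (a - z * c) = (x * a - z * b) + z * (b - x * c) := by ring
  rw [this]
  exact I.add_mem hb (I.mul_mem_left _ hc)

/-- Prime avoidance: an ideal annihilating no nonzero element of a finite module contains a
regular element. -/
theorem exists_isSMulRegular_of_forall_smul_eq_zero {A M : Type*} [CommRing A]
    [IsNoetherianRing A] [AddCommGroup M] [Module A M] [Module.Finite A M] (p : Ideal A)
    (h : ∀ b : M, (∀ x ∈ p, x • b = 0) → b = 0) : ∃ z ∈ p, IsSMulRegular M z := by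
  by_contra! hcon
  have hsub : (p : Set A) ⊆ ⋃ q ∈ associatedPrimes A M, q := by
    rw [biUnion_associatedPrimes_eq_compl_regular A M]
    exact fun x hx => hcon x hx
  obtain ⟨q, hq, hpq⟩ := (Ideal.subset_union_prime_finite (associatedPrimes.finite A M)
    (f := id) ⊥ ⊥ (fun i hi _ _ => hi.1)).1 hsub
  obtain ⟨hqp, b, hb⟩ := isAssociatedPrime_iff.1 hq
  have hb0 : b = 0 := h b fun x hx => by
    have := hpq hx
    simpa [hb] using this
  apply hqp.ne_top
  simp [hb, hb0]

theorem isRegularModulo_iff_isSMulRegular {A : Type*} [CommRing A] {I : Ideal A} {x : A} :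
    IsRegularModulo I x ↔ IsSMulRegular (A ⧸ I) x := by
  rw [isSMulRegular_iff_right_eq_zero_of_smul]
  constructor
  · intro h m hm
    obtain ⟨a, rfl⟩ := Ideal.Quotient.mk_surjective m
    rw [← Ideal.Quotient.mk_eq_mk, ← Submodule.Quotient.mk_smul,
      Submodule.Quotient.mk_eq_zero] at hm
    exact Ideal.Quotient.eq_zero_iff_mem.2 (h a hm)
  · intro h a ha
    have := h (Submodule.Quotient.mk a) (by
      rw [← Submodule.Quotient.mk_smul, Submodule.Quotient.mk_eq_zero]
      exact ha)
    rwa [Submodule.Quotient.mk_eq_zero] at this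

theorem smul_mk_eq_zero_iff {A : Type*} [CommRing A] {I : Ideal A} {x a : A} :
    x • Ideal.Quotient.mk I a = 0 ↔ x * a ∈ I := by
  rw [← Ideal.Quotient.eq_zero_iff_mem, map_mul]
  rfl

theorem exists_isRegularModulo_of_forall_mul_mem {A : Type*} [CommRing A]
    [IsNoetherianRing A] (p I : Ideal A)
    (h : ∀ b, (∀ x ∈ p, x * b ∈ I) → b ∈ I) : ∃ z ∈ p, IsRegularModulo I z := by
  simp_rw [isRegularModulo_iff_isSMulRegular]
  refine exists_isSMulRegular_of_forall_smul_eq_zero p fun b hb => ?_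
  obtain ⟨b, rfl⟩ := Ideal.Quotient.mk_surjective b
  exact Ideal.Quotient.eq_zero_iff_mem.2 (h b fun x hx => smul_mk_eq_zero_iff.1 (hb x hx))

theorem exists_isRegularModulo_three {A : Type*} [CommRing A]
    [IsNoetherianRing A] (p I₁ I₂ I₃ : Ideal A)
    (h₁ : ∀ b, (∀ x ∈ p, x * b ∈ I₁) → b ∈ I₁)
    (h₂ : ∀ b, (∀ x ∈ p, x * b ∈ I₂) → b ∈ I₂)
    (h₃ : ∀ b, (∀ x ∈ p, x * b ∈ I₃) → b ∈ I₃) :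
    ∃ z ∈ p, IsRegularModulo I₁ z ∧ IsRegularModulo I₂ z ∧ IsRegularModulo I₃ z := by
  obtain ⟨z, hz, hreg⟩ := exists_isSMulRegular_of_forall_smul_eq_zero
    (M := (A ⧸ I₁) × (A ⧸ I₂) × (A ⧸ I₃)) p (by
      rintro ⟨b₁, b₂, b₃⟩ hb
      obtain ⟨b₁, rfl⟩ := Ideal.Quotient.mk_surjective b₁
      obtain ⟨b₂, rfl⟩ := Ideal.Quotient.mk_surjective b₂
      obtain ⟨b₃, rfl⟩ := Ideal.Quotient.mk_surjective b₃
      simp only [Prod.smul_mk, Prod.mk_eq_zero, smul_mk_eq_zero_iff] at hb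
      simp only [Prod.mk_eq_zero, Ideal.Quotient.eq_zero_iff_mem]
      exact ⟨h₁ _ fun x hx => (hb x hx).1, h₂ _ fun x hx => (hb x hx).2.1,
        h₃ _ fun x hx => (hb x hx).2.2⟩)
  rw [isSMulRegular_iff_right_eq_zero_of_smul] at hreg
  refine ⟨z, hz, fun a ha => ?_, fun a ha => ?_, fun a ha => ?_⟩
  · have := hreg (Ideal.Quotient.mk I₁ a, 0, 0) (by simp [smul_mk_eq_zero_iff, ha])
    simpa [Ideal.Quotient.eq_zero_iff_mem] using this
  · have := hreg (0, Ideal.Quotient.mk I₂ a, 0) (by simp [smul_mk_eq_zero_iff, ha])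
    simpa [Ideal.Quotient.eq_zero_iff_mem] using this
  · have := hreg (0, 0, Ideal.Quotient.mk I₃ a) (by simp [smul_mk_eq_zero_iff, ha])
    simpa [Ideal.Quotient.eq_zero_iff_mem] using this

/-- Dividing by a regular element lowers the length of available regular sequences by at most
one. -/
theorem HasWeaklyRegularSeq.sup_span_singleton {A : Type*} [CommRing A] [IsNoetherianRing A]
    {J : Ideal A} {n : ℕ} {I : Ideal A} {y : A} (h : HasWeaklyRegularSeq J (n + 1) I)
    (hy : y ∈ J) (hreg : IsRegularModulo I y) :
    HasWeaklyRegularSeq J n (I ⊔ Ideal.span {y}) := by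
  induction n generalizing I y with
  | zero => exact .zero _
  | succ n ih =>
    obtain _ | ⟨_, _, x, hx, hxreg, hx2⟩ := h
    obtain ⟨x₂, hx₂, hx₂reg⟩ : ∃ x₂ ∈ J, IsRegularModulo (I ⊔ Ideal.span {x}) x₂ := by
      cases hx2 with
      | succ _ _ x₂ h1 h2 _ => exact ⟨x₂, h1, h2⟩
    have hsoc : ∀ b, (∀ t ∈ J, t * b ∈ I ⊔ Ideal.span {x}) → b ∈ I ⊔ Ideal.span {x} :=
      fun b hb => hx₂reg b (hb _ hx₂)
    obtain ⟨z, hz, hz1, hz2, hz3⟩ := exists_isRegularModulo_three J I (I ⊔ Ideal.span {x})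
      (I ⊔ Ideal.span {y}) (fun b hb => hxreg b (hb _ hx)) hsoc (by
        intro u hu
        obtain ⟨v, hv⟩ := mem_sup_span_singleton_iff.1 (hu x hx)
        have hvmem : v ∈ I ⊔ Ideal.span {x} := by
          refine hsoc v fun t ht => ?_
          obtain ⟨w, hw⟩ := mem_sup_span_singleton_iff.1 (hu t ht)
          refine mem_sup_span_singleton_iff.2 ⟨w, hreg _ ?_⟩
          have : y * (t * v - x * w) = x * (t * u - y * w) - t * (x * u - y * v) := by ring
          rw [this]
          exact I.sub_mem (I.mul_mem_left _ hw) (I.mul_mem_left _ hv)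
        obtain ⟨w, hw⟩ := mem_sup_span_singleton_iff.1 hvmem
        refine mem_sup_span_singleton_iff.2 ⟨w, hxreg _ ?_⟩
        have : x * (u - y * w) = (x * u - y * v) + y * (v - x * w) := by ring
        rw [this]
        exact I.add_mem hv (I.mul_mem_left _ hw))
    have hxz : HasWeaklyRegularSeq J (n + 1) (I ⊔ Ideal.span {z}) := by
      refine .succ _ _ x hx (hxreg.swap hz2) ?_
      rw [sup_right_comm]
      exact ih hx2 hz hz2
    refine .succ _ _ z hz hz3 ?_
    rw [sup_right_comm]
    exact ih hxz hy (hreg.swap hz3)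

theorem exists_prime_eq_colon_singleton {A : Type*} [CommRing A] [IsNoetherianRing A]
    {I : Ideal A} {b : A} (hb : b ∉ I) :
    ∃ q : PrimeSpectrum A, (∃ b', ∀ x, x ∈ q.asIdeal ↔ x * b' ∈ I) ∧
      ∀ x, x * b ∈ I → x ∈ q.asIdeal := by
  obtain ⟨q, hq, hle⟩ := exists_le_isAssociatedPrime_of_isNoetherianRing A
    (Ideal.Quotient.mk I b) (by rwa [ne_eq, Ideal.Quotient.eq_zero_iff_mem])
  obtain ⟨hqp, c, hc⟩ := isAssociatedPrime_iff.1 hq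
  obtain ⟨c, rfl⟩ := Ideal.Quotient.mk_surjective c
  refine ⟨⟨q, hqp⟩, ⟨c, fun x => ?_⟩, fun x hx => hle ?_⟩
  · change x ∈ q ↔ _
    rw [hc, Submodule.mem_colon_singleton, Submodule.mem_bot, smul_mk_eq_zero_iff]
  · rwa [Submodule.mem_colon_singleton, Submodule.mem_bot, smul_mk_eq_zero_iff]

/-- The length of a regular sequence modulo `I` is at most the dimension of `A ⧸ p` for every
associated prime `p` of `A ⧸ I`. -/
theorem HasWeaklyRegularSeq.le_coheight {A : Type*} [CommRing A] [IsNoetherianRing A]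
    {J : Ideal A} (hJ : J ≤ Ideal.jacobson ⊥) {n : ℕ} {I : Ideal A}
    (h : HasWeaklyRegularSeq J n I) (p : PrimeSpectrum A) {a : A}
    (hp : ∀ x, x ∈ p.asIdeal ↔ x * a ∈ I) : (n : ℕ∞) ≤ Order.coheight p := by
  induction h generalizing p a with
  | zero I => simp
  | succ n I x hx hreg h ih =>
    let N : Ideal A := Submodule.colon I (p.asIdeal : Set A)
    have haI : a ∉ I := fun ha => p.isPrime.ne_top
      ((Ideal.eq_top_iff_one _).2 ((hp 1).2 (by simpa using ha)))
    have haN : a ∈ N := Submodule.mem_colon.2 fun y hy => by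
      rw [smul_eq_mul, mul_comm]; exact (hp y).1 hy
    have hxp : x ∉ p.asIdeal := fun hxp => haI (hreg a ((hp x).1 hxp))
    obtain ⟨b, hbN, hb⟩ : ∃ b ∈ N, b ∉ I ⊔ Ideal.span {x} := by
      by_contra! hcon
      refine haI (Submodule.le_of_le_smul_of_le_jacobson_bot (I := J) (N := I) (N' := N)
        (IsNoetherian.noetherian N) hJ (fun b hb => ?_) haN)
      obtain ⟨c, hc⟩ := mem_sup_span_singleton_iff.1 (hcon b hb)
      have hcN : c ∈ N := Submodule.mem_colon.2 fun y hy => by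
        rw [smul_eq_mul]
        refine hreg _ ?_
        have : x * (c * y) = b • y - y * (b - x * c) := by rw [smul_eq_mul]; ring
        rw [this]
        exact I.sub_mem (Submodule.mem_colon.1 hb y hy) (I.mul_mem_left _ hc)
      have : b = (b - x * c) + x • c := by rw [smul_eq_mul]; ring
      rw [this]
      exact Submodule.add_mem_sup hc (Submodule.smul_mem_smul hx hcN)
    obtain ⟨q, ⟨b', hq⟩, hle⟩ := exists_prime_eq_colon_singleton hb
    have hpq : p < q := by
      refine lt_of_le_of_ne (fun y hy => hle y ?_) ?_
      · rw [mul_comm]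
        exact Ideal.mem_sup_left (Submodule.mem_colon.1 hbN y hy)
      · rintro rfl
        exact hxp (hle x (Ideal.mem_sup_right
          (Ideal.mul_mem_right _ _ (Ideal.mem_span_singleton_self x))))
    calc ((n + 1 : ℕ) : ℕ∞) = n + 1 := by push_cast; rfl
      _ ≤ Order.coheight q + 1 := by gcongr; exact ih q hq
      _ ≤ Order.coheight p := Order.coheight_add_one_le hpq

theorem HasWeaklyRegularSeq.exists_ltSeries {A : Type*} [CommRing A] [IsNoetherianRing A]
    {J : Ideal A} (hJ : J ≤ Ideal.jacobson ⊥) {n : ℕ} {I : Ideal A}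
    (h : HasWeaklyRegularSeq J n I) (p : PrimeSpectrum A) (hIp : I ≤ p.asIdeal)
    (hpJ : p.asIdeal ≤ J) :
    ∃ l : LTSeries (PrimeSpectrum A), l.last = p ∧ I ≤ l.head.asIdeal ∧
      (n : ℕ∞) ≤ l.length + Order.coheight p := by
  induction n generalizing I with
  | zero => exact ⟨RelSeries.singleton _ p, rfl, hIp, by simp⟩
  | succ n ih =>
    by_cases hex : ∃ y ∈ p.asIdeal, IsRegularModulo I y
    · obtain ⟨y, hy, hreg⟩ := hex
      obtain ⟨l, hl, hle, hn⟩ := ih (h.sup_span_singleton (hpJ hy) hreg)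
        (sup_le hIp ((Ideal.span_singleton_le_iff_mem _).2 hy))
      obtain ⟨q, hq, hql⟩ := Ideal.exists_minimalPrimes_le (le_sup_left.trans hle)
      have hyq : y ∉ q := by
        intro hyq
        obtain ⟨b, hb⟩ := Submodule.exists_eq_colon_of_mem_minimalPrimes (N := I) (x := (1 : A))
          (I := q) (by
            have : Submodule.colon I {(1 : A)} = I := by
              ext; simp [Submodule.mem_colon_singleton]
            rwa [this])
        have hbI : b ∈ I := hreg b (by simpa [hb, Submodule.mem_colon_singleton] using hyq)
        apply hq.1.1.ne_top
        rw [hb]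
        simpa using hbI
      let q' : PrimeSpectrum A := ⟨q, hq.1.1⟩
      have hlt : q' < l.head := lt_of_le_of_ne hql fun heq => hyq (by
        have : y ∈ l.head.asIdeal :=
          hle (Ideal.mem_sup_right (Ideal.mem_span_singleton_self y))
        rwa [← heq] at this)
      refine ⟨l.cons q' hlt, by simpa using hl, by simpa using hq.1.2, ?_⟩
      have : ((l.cons q' hlt).length : ℕ∞) = l.length + 1 := by simp
      rw [this]
      push_cast
      rw [add_right_comm]
      gcongr
    · obtain ⟨b, hb, hbI⟩ : ∃ b, (∀ x ∈ p.asIdeal, x * b ∈ I) ∧ b ∉ I := by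
        by_contra! hcon
        exact hex (exists_isRegularModulo_of_forall_mul_mem _ _ hcon)
      obtain ⟨q, ⟨b', hq⟩, hle⟩ := exists_prime_eq_colon_singleton hbI
      refine ⟨RelSeries.singleton _ p, rfl, hIp, ?_⟩
      have hpq : p ≤ q := fun x hx => hle x (hb x hx)
      simpa using (h.le_coheight hJ q hq).trans (Order.coheight_anti hpq)

/-- If a local ring carries a regular sequence of length `n`, then
`n ≤ ht p + dim A ⧸ p` for every prime `p`. -/
theorem HasWeaklyRegularSeq.le_height_add_coheight {A : Type*} [CommRing A]
    [IsNoetherianRing A] {J : Ideal A} (hJ : J ≤ Ideal.jacobson ⊥) {n : ℕ}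
    (h : HasWeaklyRegularSeq J n ⊥) (p : PrimeSpectrum A) (hpJ : p.asIdeal ≤ J) :
    (n : ℕ∞) ≤ Order.height p + Order.coheight p := by
  obtain ⟨l, hl, -, hn⟩ := h.exists_ltSeries hJ p bot_le hpJ
  refine hn.trans ?_
  gcongr
  rw [← hl]
  exact Order.length_le_height_last

theorem HasWeaklyRegularSeq.of_isWeaklyRegular {R : Type*} [CommRing R] {J : Ideal R}
    {rs : List R} (h : RingTheory.Sequence.IsWeaklyRegular R rs) (hJ : ∀ x ∈ rs, x ∈ J) :
    HasWeaklyRegularSeq J rs.length ⊥ := by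
  suffices ∀ k i, i + k = rs.length → HasWeaklyRegularSeq J k (Ideal.ofList (rs.take i)) by
    simpa using this rs.length 0 (by simp)
  intro k
  induction k with
  | zero => exact fun i _ => .zero _
  | succ k ih =>
    intro i hi
    have hlt : i < rs.length := by omega
    refine .succ _ _ rs[i] (hJ _ (List.getElem_mem hlt)) (fun a ha => ?_) ?_
    · have hreg := isSMulRegular_iff_right_eq_zero_of_smul.1 (h.regular_mod_prev i hlt)
        (Submodule.Quotient.mk a)
      rw [← Submodule.Quotient.mk_smul, Submodule.Quotient.mk_eq_zero,
        Submodule.Quotient.mk_eq_zero] at hreg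
      simpa using hreg (by simpa using ha)
    · have := ih (i + 1) (by omega)
      rwa [List.take_succ_eq_append_getElem hlt, Ideal.ofList_append,
        Ideal.ofList_singleton] at this

theorem HasWeaklyRegularSeq.mono {A : Type*} [CommRing A] {J : Ideal A} {m n : ℕ}
    {I : Ideal A} (h : HasWeaklyRegularSeq J n I) (hmn : m ≤ n) :
    HasWeaklyRegularSeq J m I := by
  induction h generalizing m with
  | zero I =>
    obtain rfl : m = 0 := by omega
    exact .zero _
  | succ n I x hx hreg h ih =>
    cases m with
    | zero => exact .zero _
    | succ m => exact .succ _ _ x hx hreg (ih (by omega))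

theorem IsCohenMacaulayLocalRing.exists_hasWeaklyRegularSeq {R : Type*} [CommRing R]
    [IsNoetherianRing R] [IsLocalRing R] (hCM : IsCohenMacaulayLocalRing R) :
    ∃ d : ℕ, ringKrullDim R = d ∧
      HasWeaklyRegularSeq (IsLocalRing.maximalIdeal R) d ⊥ := by
  obtain ⟨d, hd⟩ : ∃ d : ℕ, ringKrullDim R = d := by
    obtain ⟨e, he⟩ := WithBot.ne_bot_iff_exists.1 (ringKrullDim_ne_bot (R := R))
    have hetop : e ≠ ⊤ := by
      rintro rfl
      exact ringKrullDim_ne_top he.symm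
    obtain ⟨d, rfl⟩ := ENat.ne_top_iff_exists.1 hetop
    exact ⟨d, he.symm⟩
  refine ⟨d, hd, ?_⟩
  cases d with
  | zero => exact .zero _
  | succ d =>
    have hdepth : ringDepth R = (d + 1 : ℕ) := by
      unfold IsCohenMacaulayLocalRing at hCM
      rw [hd] at hCM
      exact_mod_cast hCM
    have hlt : (d : ℕ∞) < ringDepth R := by
      rw [hdepth]
      exact_mod_cast Nat.lt_succ_self d
    simp only [ringDepth, lt_iSup_iff] at hlt
    obtain ⟨rs, hrs, hreg, hlt⟩ := hlt
    exact (HasWeaklyRegularSeq.of_isWeaklyRegular hreg.toIsWeaklyRegular hrs).mono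
      (by exact_mod_cast hlt)

theorem HasWeaklyRegularSeq.comap {A B : Type*} [CommRing A] [CommRing B] {φ : A →+* B}
    (hφ : Function.Surjective φ) {J : Ideal B} {n : ℕ} {I : Ideal B}
    (h : HasWeaklyRegularSeq J n I) :
    HasWeaklyRegularSeq (J.comap φ) n (I.comap φ) := by
  induction h with
  | zero I => exact .zero _
  | succ n I x hx hreg h ih =>
    obtain ⟨x, rfl⟩ := hφ x
    refine .succ _ _ x hx (fun a ha => hreg _ (by simpa using ha)) ?_
    convert ih using 1
    ext a
    rw [mem_sup_span_singleton_iff, Ideal.mem_comap, mem_sup_span_singleton_iff]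
    simp [hφ.exists]

theorem HasWeaklyRegularSeq.map_localization {A B : Type*} [CommRing A] [CommRing B]
    [Algebra A B] (M : Submonoid A) [IsLocalization M B] {J : Ideal A} {n : ℕ} {I : Ideal A}
    (h : HasWeaklyRegularSeq J n I) :
    HasWeaklyRegularSeq (J.map (algebraMap A B)) n (I.map (algebraMap A B)) := by
  induction h with
  | zero I => exact .zero _
  | succ n I x hx hreg h ih =>
    refine .succ _ _ (algebraMap A B x) (Ideal.mem_map_of_mem _ hx) (fun a ha => ?_) ?_
    · obtain ⟨a, t, rfl⟩ := IsLocalization.exists_mk'_eq M a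
      rw [IsLocalization.mul_mk'_eq_mk'_of_mul, IsLocalization.mk'_mem_map_algebraMap_iff] at ha
      obtain ⟨u, hu, hmem⟩ := ha
      rw [IsLocalization.mk'_mem_map_algebraMap_iff]
      refine ⟨u, hu, hreg _ ?_⟩
      rwa [mul_left_comm]
    · rwa [Ideal.map_sup, Ideal.map_span, Set.image_singleton] at ih

section PartialEvaluation

variable {R σ : Type*} [CommRing R]

theorem MvPolynomial.eq_zero_of_X_sub_C_mul_eq_zero (c : σ → R) (u : σ)
    {g : MvPolynomial σ R} (h : (X u - C (c u)) * g = 0) : g = 0 := by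
  let ψ : MvPolynomial σ R →ₐ[R] MvPolynomial σ R := aeval fun t => X t + C (c t)
  let ψ' : MvPolynomial σ R →ₐ[R] MvPolynomial σ R := aeval fun t => X t - C (c t)
  have hinv : ψ'.comp ψ = AlgHom.id R _ := by
    ext t : 1
    simp [ψ, ψ', algHom_C, algebraMap_eq]
  have hψ : X u * ψ g = X u * 0 := by
    have := congrArg ψ h
    simpa [ψ, algHom_C, algebraMap_eq] using this
  have h0 : ψ g = 0 := X_mul_cancel_left_iff.1 hψ
  have := DFunLike.congr_fun hinv g
  rw [AlgHom.comp_apply, h0, map_zero] at this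
  simpa using this.symm

theorem MvPolynomial.isRegularModulo_X_sub_C (c : σ → R) (T : Set σ) {u : σ} (hu : u ∉ T) :
    IsRegularModulo (Ideal.span ((fun t => X t - C (c t) : σ → MvPolynomial σ R) '' T))
      (X u - C (c u)) := by
  classical
  set K := Ideal.span ((fun t => X t - C (c t) : σ → MvPolynomial σ R) '' T)
  let φ : MvPolynomial σ R →ₐ[R] MvPolynomial σ R :=
    aeval fun t => if t ∈ T then C (c t) else X t
  have hmk : (Ideal.Quotient.mkₐ R K).comp φ = Ideal.Quotient.mkₐ R K := by
    ext t : 1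
    by_cases ht : t ∈ T
    · simp only [φ, AlgHom.comp_apply, aeval_X, if_pos ht, Ideal.Quotient.mkₐ_eq_mk]
      refine (Ideal.Quotient.eq.2 ?_).symm
      exact Ideal.subset_span ⟨t, ht, rfl⟩
    · simp [φ, ht]
  have hK : K ≤ RingHom.ker φ := by
    refine Ideal.span_le.2 ?_
    rintro _ ⟨t, ht, rfl⟩
    simp [φ, ht, RingHom.mem_ker, algHom_C, algebraMap_eq]
  intro g hg
  have h0 : (X u - C (c u)) * φ g = 0 := by
    have := hK hg
    rw [RingHom.mem_ker] at this
    simpa [φ, hu, algHom_C, algebraMap_eq] using this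
  have hφg := eq_zero_of_X_sub_C_mul_eq_zero c u h0
  have := DFunLike.congr_fun hmk g
  rw [AlgHom.comp_apply, hφg, map_zero] at this
  exact Ideal.Quotient.eq_zero_iff_mem.1 this.symm

theorem MvPolynomial.sub_C_eval_mem_span (c : σ → R) (g : MvPolynomial σ R) :
    g - C (eval c g) ∈ Ideal.span (Set.range fun t => X t - C (c t) : Set (MvPolynomial σ R)) := by
  set K := Ideal.span (Set.range fun t => X t - C (c t) : Set (MvPolynomial σ R))
  have hmk : (Ideal.Quotient.mkₐ R K) = (Ideal.Quotient.mkₐ R K).comp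
      ((Algebra.ofId R (MvPolynomial σ R)).comp (aeval c)) := by
    ext t : 1
    simp only [AlgHom.comp_apply, aeval_X, Ideal.Quotient.mkₐ_eq_mk]
    refine Ideal.Quotient.eq.2 (Ideal.subset_span ⟨t, rfl⟩)
  have := DFunLike.congr_fun hmk g
  exact Ideal.Quotient.eq.1 this

theorem MvPolynomial.comap_eval_bot (c : σ → R) :
    (⊥ : Ideal R).comap (eval c) =
      Ideal.span (Set.range fun t => X t - C (c t) : Set (MvPolynomial σ R)) := by
  refine le_antisymm (fun g hg => ?_) (Ideal.span_le.2 ?_)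
  · have := sub_C_eval_mem_span c g
    rwa [show eval c g = 0 from hg, C_0, sub_zero] at this
  · rintro _ ⟨t, rfl⟩
    simp

/-- A regular sequence of `R` extends to one of `R[σ]` by the elements `X t - c t`. -/
theorem HasWeaklyRegularSeq.mvPolynomial [Fintype σ] (c : σ → R) {J : Ideal R} {d : ℕ}
    (h : HasWeaklyRegularSeq J d ⊥) :
    HasWeaklyRegularSeq (J.comap (eval c)) (d + Fintype.card σ) ⊥ := by
  classical
  suffices ∀ T : Finset σ, HasWeaklyRegularSeq (J.comap (eval c)) (d + T.card)
      (Ideal.span ((fun t => X t - C (c t) : σ → MvPolynomial σ R) '' (T : Set σ)ᶜ)) by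
    simpa using this Finset.univ
  intro T
  induction T using Finset.induction_on with
  | empty =>
    have := h.comap (φ := eval c) fun a => ⟨C a, by simp⟩
    rw [comap_eval_bot] at this
    simpa using this
  | insert u T hu ih =>
    rw [Finset.card_insert_of_notMem hu, ← add_assoc]
    refine .succ _ _ (X u - C (c u)) (by simp [Ideal.mem_comap])
      (isRegularModulo_X_sub_C c _ (by simp)) ?_
    convert ih using 1
    rw [← Ideal.span_union]
    congr 1
    have : ((T : Set σ))ᶜ = (↑(insert u T) : Set σ)ᶜ ∪ {u} := by
      ext t
      by_cases htu : t = u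
      · simp [htu, hu]
      · simp [htu]
    rw [this, Set.image_union, Set.image_singleton]

end PartialEvaluation

/-- The determinantal trick: modulo `(X p - c p)`, a power of every element of `𝔞 : I` lies in the
generic residual. -/
theorem C_mem_of_mem_colon_of_genericResidual_le {R : Type*} [CommRing R] {r s : ℕ}
    (f : Fin r → R) (c : Fin r → Fin s → R) {q : Ideal (MvPolynomial (Fin r × Fin s) R)}
    (hq : q.IsPrime) (hres : genericResidual r s f ≤ q)
    (hX : ∀ p : Fin r × Fin s, X p - C (c p.1 p.2) ∈ q) {j : R}
    (hj : j ∈ Submodule.colon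
      (Ideal.span (Set.range fun j : Fin s => ∑ i : Fin r, c i j * f i))
      (Ideal.span (Set.range f))) : C j ∈ q := by
  classical
  set 𝔞' : Ideal (MvPolynomial (Fin r × Fin s) R) := Ideal.span (Set.range fun j : Fin s =>
      ∑ i : Fin r, (X (i, j) : MvPolynomial (Fin r × Fin s) R) * C (f i)) with h𝔞'
  have hb : ∀ i, ∃ b : Fin s → R, ∑ k, b k * ∑ l, c l k * f l = j * f i := fun i =>
    Ideal.mem_span_range_iff_exists_fun.1
      (Submodule.mem_colon.1 hj (f i) (Ideal.subset_span ⟨i, rfl⟩))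
  choose b hb using hb
  let N : Matrix (Fin r) (Fin r) (MvPolynomial (Fin r × Fin s) R) :=
    fun i l => ∑ k, C (b i k) * (X (l, k) - C (c l k))
  let T : Matrix (Fin r) (Fin r) (MvPolynomial (Fin r × Fin s) R) :=
    (C j : MvPolynomial (Fin r × Fin s) R) • 1 + N
  let F : Fin r → MvPolynomial (Fin r × Fin s) R := fun i => C (f i)
  have hTF : ∀ i, (T.mulVec F) i ∈ 𝔞' := by
    intro i
    have : (T.mulVec F) i = ∑ k, C (b i k) * ∑ l, X (l, k) * C (f l) := by
      have hNF : (N.mulVec F) i =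
          ∑ k, C (b i k) * ∑ l, (X (l, k) - C (c l k)) * C (f l) := by
        simp only [Matrix.mulVec, dotProduct, N, F, Finset.sum_mul, Finset.mul_sum]
        rw [Finset.sum_comm]
        simp only [mul_assoc]
      have hji : (C j : MvPolynomial (Fin r × Fin s) R) * C (f i) =
          ∑ k, C (b i k) * ∑ l, C (c l k) * C (f l) := by
        rw [← C_mul, ← hb i]
        simp
      simp only [T, Matrix.add_mulVec, Pi.add_apply, Matrix.smul_mulVec, Matrix.one_mulVec,
        Pi.smul_apply, smul_eq_mul]
      rw [hNF, show F i = C (f i) from rfl, hji, ← Finset.sum_add_distrib]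
      refine Finset.sum_congr rfl fun k _ => ?_
      rw [← mul_add, ← Finset.sum_add_distrib]
      congr 1
      exact Finset.sum_congr rfl fun l _ => by ring
    rw [this]
    exact Ideal.sum_mem _ fun k _ => Ideal.mul_mem_left _ _ (Ideal.subset_span ⟨k, rfl⟩)
  have hdet : T.det ∈ genericResidual r s f := by
    refine Submodule.mem_colon.2 fun y hy => ?_
    have hle : (Ideal.span (Set.range f)).map (C : R →+* MvPolynomial (Fin r × Fin s) R) ≤
        Submodule.colon 𝔞' {T.det} := by
      rw [Ideal.map_span, Ideal.span_le]
      rintro _ ⟨_, ⟨i, rfl⟩, rfl⟩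
      rw [SetLike.mem_coe, Submodule.mem_colon_singleton, smul_eq_mul, mul_comm]
      have : T.det * C (f i) = (T.adjugate.mulVec (T.mulVec F)) i := by
        rw [Matrix.mulVec_mulVec, Matrix.adjugate_mul, Matrix.smul_mulVec, Matrix.one_mulVec]
        rfl
      rw [this, Matrix.mulVec, dotProduct]
      exact Ideal.sum_mem _ fun l _ => Ideal.mul_mem_left _ _ (hTF l)
    have := Submodule.mem_colon_singleton.1 (hle hy)
    rwa [smul_eq_mul, mul_comm] at this
  have hmk : Ideal.Quotient.mk q T.det = Ideal.Quotient.mk q (C j ^ r) := by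
    have hT : (Ideal.Quotient.mk q).mapMatrix T = (Ideal.Quotient.mk q (C j)) • 1 := by
      ext i l
      have hN : Ideal.Quotient.mk q (N i l) = 0 :=
        Ideal.Quotient.eq_zero_iff_mem.2
          (Ideal.sum_mem _ fun k _ => Ideal.mul_mem_left _ _ (hX (l, k)))
      simp only [RingHom.mapMatrix_apply, Matrix.map_apply, T, Matrix.add_apply,
        Matrix.smul_apply, smul_eq_mul, map_add, map_mul, hN, add_zero, Matrix.one_apply]
      split_ifs <;> simp
    rw [RingHom.map_det, hT, Matrix.det_smul, Matrix.det_one, mul_one, Fintype.card_fin, map_pow]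
  have hpow : (C j : MvPolynomial (Fin r × Fin s) R) ^ r ∈ q := by
    rw [← Ideal.Quotient.eq_zero_iff_mem, ← hmk, Ideal.Quotient.eq_zero_iff_mem]
    exact hres hdet
  exact hq.mem_of_pow_mem _ hpow

/-- Colon by a finitely generated ideal commutes with localization. -/
theorem map_colon_eq_of_isLocalization {A B : Type*} [CommRing A] [CommRing B] [Algebra A B]
    (M : Submonoid A) [IsLocalization M B] (I K : Ideal A) (hK : K.FG) :
    (Submodule.colon I (K : Set A)).map (algebraMap A B) =
      Submodule.colon (I.map (algebraMap A B)) (K.map (algebraMap A B) : Set B) := by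
  classical
  refine le_antisymm (Ideal.map_le_iff_le_comap.2 fun x hx => ?_) fun z hz => ?_
  · refine Submodule.mem_colon.2 fun y hy => ?_
    have hle : K.map (algebraMap A B) ≤
        Submodule.colon (I.map (algebraMap A B)) {algebraMap A B x} := by
      refine Ideal.map_le_iff_le_comap.2 fun k hk => ?_
      rw [Ideal.mem_comap, Submodule.mem_colon_singleton, smul_eq_mul, mul_comm, ← map_mul]
      exact Ideal.mem_map_of_mem _ (Submodule.mem_colon.1 hx k hk)
    have := Submodule.mem_colon_singleton.1 (hle hy)
    rwa [smul_eq_mul, mul_comm] at this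
  · obtain ⟨G, rfl⟩ := hK
    obtain ⟨a, t, rfl⟩ := IsLocalization.exists_mk'_eq M z
    have hu : ∀ g ∈ G, ∃ u ∈ M, u * (a * g) ∈ I := fun g hg => by
      have := Submodule.mem_colon.1 hz _ (Ideal.mem_map_of_mem _ (Ideal.subset_span hg))
      rwa [smul_eq_mul, mul_comm, IsLocalization.mul_mk'_eq_mk'_of_mul,
        IsLocalization.mk'_mem_map_algebraMap_iff, mul_comm] at this
    choose! u huM hu using hu
    rw [IsLocalization.mk'_mem_map_algebraMap_iff]
    refine ⟨∏ g ∈ G, u g, M.prod_mem huM, ?_⟩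
    rw [Ideal.colon_span]
    refine Submodule.mem_colon.2 fun g hg => ?_
    rw [smul_eq_mul, ← Finset.prod_erase_mul _ _ hg, mul_assoc, mul_assoc]
    exact Ideal.mul_mem_left _ _ (hu g hg)

theorem PrimeSpectrum.coheight_le_krullDim_zeroLocus_add_encard {A : Type*} [CommRing A]
    [IsNoetherianRing A] [IsLocalRing A] (p : PrimeSpectrum A) {t : Set A}
    (ht : t ⊆ IsLocalRing.maximalIdeal A) :
    (Order.coheight p : WithBot ℕ∞) ≤
      Order.krullDim (PrimeSpectrum.zeroLocus ((p.asIdeal : Set A) ∪ t)) + t.encard := by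
  let π := Ideal.Quotient.mk p.asIdeal
  have hπ : Function.Surjective π := Ideal.Quotient.mk_surjective
  have : IsLocalRing (A ⧸ p.asIdeal) := .of_surjective' π hπ
  let ρ := Ideal.Quotient.mk (Ideal.span (π '' t))
  have hρ : Function.Surjective ρ := Ideal.Quotient.mk_surjective
  have h1 : (Order.coheight p : WithBot ℕ∞) = ringKrullDim (A ⧸ p.asIdeal) := by
    rw [ringKrullDim_quotient, Order.coheight_eq_krullDim_Ici]
    rfl
  have hJ : π '' t ⊆ Ring.jacobson (A ⧸ p.asIdeal) := by
    rw [IsLocalRing.ringJacobson_eq_maximalIdeal]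
    rintro _ ⟨x, hx, rfl⟩
    intro hunit
    obtain ⟨y, hy⟩ := hunit.exists_right_inv
    obtain ⟨y, rfl⟩ := hπ y
    have hxy : x * y - 1 ∈ p.asIdeal := Ideal.Quotient.eq.1 (by rw [map_mul, hy, map_one])
    refine (IsLocalRing.maximalIdeal.isMaximal A).ne_top ((Ideal.eq_top_iff_one _).2 ?_)
    rw [← sub_sub_cancel (x * y) 1]
    exact Ideal.sub_mem _ (Ideal.mul_mem_right _ _ (ht hx))
      (IsLocalRing.le_maximalIdeal p.isPrime.ne_top hxy)
  have h2 := ringKrullDim_le_ringKrullDim_quotient_add_encard _ hJ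
  rw [h1]
  refine h2.trans ?_
  have hmem (x : PrimeSpectrum ((A ⧸ p.asIdeal) ⧸ Ideal.span (π '' t))) :
      PrimeSpectrum.comap (ρ.comp π) x ∈
        PrimeSpectrum.zeroLocus ((p.asIdeal : Set A) ∪ t) := by
    rintro y (hy | hy)
    · have : π y = 0 := Ideal.Quotient.eq_zero_iff_mem.2 hy
      simp [this]
    · have : ρ (π y) = 0 := Ideal.Quotient.eq_zero_iff_mem.2 (Ideal.subset_span ⟨y, hy, rfl⟩)
      simp [this]
  gcongr
  · refine Order.krullDim_le_of_strictMono (fun x => ⟨_, hmem x⟩) ?_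
    refine Monotone.strictMono_of_injective (fun x y hxy => ?_) fun x y hxy => ?_
    · exact Ideal.comap_mono hxy
    · exact PrimeSpectrum.comap_injective_of_surjective (ρ.comp π) (hρ.comp hπ)
        (congrArg Subtype.val hxy)
  · exact WithBot.coe_le_coe.2 (Set.encard_image_le π t)

theorem Order.add_krullDim_le_of_strictMono {α β : Type*} [Preorder α] [Preorder β] {s : ℕ∞}
    (g : α → β) (hg : StrictMono g) (hs : ∀ a, s ≤ Order.height (g a)) :
    s + Order.krullDim α ≤ Order.krullDim β := by
  cases isEmpty_or_nonempty α with
  | inl h => simp [Order.krullDim_eq_bot]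
  | inr h =>
    have : Nonempty β := h.map g
    rw [Order.krullDim_eq_iSup_coheight_of_nonempty,
      Order.krullDim_eq_iSup_height_add_coheight_of_nonempty, ← WithBot.coe_add,
      WithBot.coe_le_coe, ENat.add_iSup]
    refine iSup_le fun a => le_trans ?_ (le_iSup _ (g a))
    gcongr
    · exact hs a
    · exact Order.coheight_le_coheight_apply_of_strictMono g hg a

theorem comap_eval_maximalIdeal_eq {R σ : Type*} [CommRing R] [IsLocalRing R] (c : σ → R)
    {𝔫 : Ideal (MvPolynomial σ R)} (h𝔫 : 𝔫.IsMaximal) (hX : ∀ t, X t - C (c t) ∈ 𝔫) :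
    (IsLocalRing.maximalIdeal R).comap (eval c) = 𝔫 := by
  refine (h𝔫.eq_of_le (Ideal.comap_ne_top _ Ideal.IsPrime.ne_top') fun g hg => ?_).symm
  refine (IsLocalRing.mem_maximalIdeal _).2 fun hu => h𝔫.ne_top ?_
  refine Ideal.eq_top_of_isUnit_mem _ ?_ (hu.map (C : R →+* MvPolynomial σ R))
  rw [← sub_sub_cancel g (C (eval c g))]
  refine 𝔫.sub_mem hg (Ideal.span_le.2 ?_ (MvPolynomial.sub_C_eval_mem_span c g))
  rintro _ ⟨t, rfl⟩
  exact hX t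

theorem MvPolynomial.le_of_comap_C_le {R σ : Type*} [CommRing R] (c : σ → R)
    {p q : Ideal (MvPolynomial σ R)} (hp : ∀ t, X t - C (c t) ∈ p) (hq : ∀ t, X t - C (c t) ∈ q)
    (h : p.comap C ≤ q.comap C) : p ≤ q := by
  have key : ∀ {q : Ideal (MvPolynomial σ R)}, (∀ t, X t - C (c t) ∈ q) →
      ∀ g, g - C (eval c g) ∈ q := fun {q} hq g => by
    refine Ideal.span_le.2 ?_ (MvPolynomial.sub_C_eval_mem_span c g)
    rintro _ ⟨t, rfl⟩
    exact hq t
  intro g hg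
  have hC : C (eval c g) ∈ q := h (by
    rw [Ideal.mem_comap, ← sub_sub_cancel g (C (eval c g))]
    exact p.sub_mem hg (key hp g))
  simpa using q.add_mem (key hq g) hC

/-- **Proposition 4.7.** Let `(R, 𝔪)` be a Cohen–Macaulay Noetherian local ring,
`𝔞 = (a₁, …, a_s) ⊆ I = (f₁, …, f_r)` with `a_j = Σᵢ c_{ij} fᵢ`, and suppose
`J = 𝔞 :_R I` is an `s`-residual intersection of `I` (i.e. `J` is proper with
`ht J ≥ s`).  Let `S = R[U_{ij}]`, `a'_j = Σᵢ U_{ij} fᵢ`,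
`R(s, f) = (a'₁, …, a'_s) :_S IS` and `x = (U_{ij} − c_{ij})`.  Then for every maximal
ideal `𝔫` of `S` containing `R(s, f) + (x)`, the extension `R(s, f)·S_𝔫` has height at
least `s`; in particular `R(s, f)·S_𝔫 = (a'₁, …, a'_s)S_𝔫 :_{S_𝔫} IS_𝔫` is an
`s`-residual intersection of `IS_𝔫`. -/
theorem statement8 {R : Type*} [CommRing R] [IsNoetherianRing R] [IsLocalRing R]
    (hCM : IsCohenMacaulayLocalRing R)
    {r s : ℕ} (f : Fin r → R) (c : Fin r → Fin s → R)
    (hJproper : Submodule.colon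
        (Ideal.span (Set.range fun j : Fin s => ∑ i : Fin r, c i j * f i))
        (Ideal.span (Set.range f)) ≠ ⊤)
    (hJht : (s : ℕ∞) ≤ idealHeight (Submodule.colon
        (Ideal.span (Set.range fun j : Fin s => ∑ i : Fin r, c i j * f i))
        (Ideal.span (Set.range f))))
    (𝔫 : Ideal (MvPolynomial (Fin r × Fin s) R)) (h𝔫 : 𝔫.IsMaximal)
    (h𝔫sub : genericResidual r s f ⊔
      Ideal.span (Set.range fun p : Fin r × Fin s =>
        (X p : MvPolynomial (Fin r × Fin s) R) - C (c p.1 p.2)) ≤ 𝔫) :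
    haveI : 𝔫.IsPrime := h𝔫.isPrime
    ((genericResidual r s f).map
        (algebraMap (MvPolynomial (Fin r × Fin s) R) (Localization.AtPrime 𝔫)) ≠ ⊤ ∧
      (s : ℕ∞) ≤ idealHeight ((genericResidual r s f).map
        (algebraMap (MvPolynomial (Fin r × Fin s) R) (Localization.AtPrime 𝔫))) ∧
      (genericResidual r s f).map
          (algebraMap (MvPolynomial (Fin r × Fin s) R) (Localization.AtPrime 𝔫)) =
        Submodule.colon
          ((Ideal.span (Set.range fun j : Fin s =>
            ∑ i : Fin r, (X (i, j) : MvPolynomial (Fin r × Fin s) R) * C (f i))).map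
              (algebraMap (MvPolynomial (Fin r × Fin s) R) (Localization.AtPrime 𝔫)))
          (((Ideal.span (Set.range f)).map
              (C : R →+* MvPolynomial (Fin r × Fin s) R)).map
            (algebraMap (MvPolynomial (Fin r × Fin s) R) (Localization.AtPrime 𝔫)))) := by
  have : 𝔫.IsPrime := h𝔫.isPrime
  have hX : ∀ p : Fin r × Fin s, X p - C (c p.1 p.2) ∈ 𝔫 := fun p =>
    h𝔫sub (Ideal.mem_sup_right (Ideal.subset_span ⟨p, rfl⟩))
  have hres : genericResidual r s f ≤ 𝔫 := le_sup_left.trans h𝔫sub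
  set A := Localization.AtPrime 𝔫
  set ι := algebraMap (MvPolynomial (Fin r × Fin s) R) A
  have h𝔫A : 𝔫.map ι = IsLocalRing.maximalIdeal A := Localization.AtPrime.map_eq_maximalIdeal
  have : IsNoetherianRing A := IsLocalization.isNoetherianRing 𝔫.primeCompl A inferInstance
  refine ⟨?_, ?_, ?_⟩
  · exact ne_top_of_le_ne_top (IsLocalRing.maximalIdeal.isMaximal A).ne_top
      ((Ideal.map_mono hres).trans h𝔫A.le)
  · refine le_iInf₂ fun p hp => ?_
    obtain ⟨d, hd, hreg⟩ := hCM.exists_hasWeaklyRegularSeq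
    have hregA := (hreg.mvPolynomial fun p : Fin r × Fin s => c p.1 p.2).map_localization
      (B := A) 𝔫.primeCompl
    rw [Ideal.map_bot, comap_eval_maximalIdeal_eq _ h𝔫 hX, h𝔫A] at hregA
    have hle := hregA.le_height_add_coheight (IsLocalRing.maximalIdeal_le_jacobson _) p
      (IsLocalRing.le_maximalIdeal p.2.ne_top)
    let x : Set A := Set.range fun p : Fin r × Fin s => ι (X p - C (c p.1 p.2))
    have hx : x ⊆ IsLocalRing.maximalIdeal A := by
      rintro _ ⟨t, rfl⟩
      exact h𝔫A ▸ Ideal.mem_map_of_mem ι (hX t)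
    have hxcard : x.encard ≤ Fintype.card (Fin r × Fin s) := by
      rw [show x = Set.range _ from rfl, ← Set.image_univ]
      exact (Set.encard_image_le _ _).trans (by simp [Set.encard_univ])
    have hmem : ∀ y ∈ PrimeSpectrum.zeroLocus ((p.asIdeal : Set A) ∪ x),
        ∀ t : Fin r × Fin s, X t - C (c t.1 t.2) ∈ y.asIdeal.comap ι :=
      fun y hy t => hy (Or.inr ⟨t, rfl⟩)
    let g : PrimeSpectrum.zeroLocus ((p.asIdeal : Set A) ∪ x) → PrimeSpectrum R :=
      fun y => PrimeSpectrum.comap (ι.comp C) y.1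
    have hg : StrictMono g := by
      refine Monotone.strictMono_of_injective (fun y z hyz => Ideal.comap_mono hyz)
        fun y z hyz => Subtype.ext ?_
      refine PrimeSpectrum.localization_comap_injective A 𝔫.primeCompl (PrimeSpectrum.ext ?_)
      have h : (y.1.asIdeal.comap ι).comap C = (z.1.asIdeal.comap ι).comap C :=
        congrArg PrimeSpectrum.asIdeal hyz
      exact le_antisymm
        (MvPolynomial.le_of_comap_C_le _ (hmem y y.2) (hmem z z.2) h.le)
        (MvPolynomial.le_of_comap_C_le _ (hmem z z.2) (hmem y y.2) h.ge)
    have hs : ∀ y, (s : ℕ∞) ≤ Order.height (g y) := fun y =>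
      hJht.trans (iInf₂_le (g y) fun j hj =>
        C_mem_of_mem_colon_of_genericResidual_le f c (y.1.2.comap ι)
          (Ideal.map_le_iff_le_comap.1 (hp.trans fun a ha => y.2 (Or.inl ha))) (hmem y y.2) hj)
    have hdim := Order.add_krullDim_le_of_strictMono g hg hs
    have hco := PrimeSpectrum.coheight_le_krullDim_zeroLocus_add_encard p hx
    have h1 : ((s + Order.coheight p : ℕ∞) : WithBot ℕ∞) ≤
        ((d + Fintype.card (Fin r × Fin s) : ℕ) : ℕ∞) := by
      calc ((s + Order.coheight p : ℕ∞) : WithBot ℕ∞)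
          = (s : ℕ∞) + (Order.coheight p : WithBot ℕ∞) := by push_cast; rfl
        _ ≤ (s : ℕ∞) + (Order.krullDim (PrimeSpectrum.zeroLocus ((p.asIdeal : Set A) ∪ x)) +
              x.encard) := by gcongr
        _ ≤ d + (Fintype.card (Fin r × Fin s) : ℕ∞) := by
          rw [← add_assoc]
          exact add_le_add (hdim.trans hd.le) (WithBot.coe_le_coe.2 hxcard)
        _ = _ := by push_cast; rfl
    rw [WithBot.coe_le_coe] at h1
    have hfin : Order.coheight p ≠ ⊤ := fun h => by
      rw [h, add_top, top_le_iff] at h1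
      exact ENat.natCast_ne_top _ h1
    exact (ENat.add_le_add_iff_right hfin).1 (h1.trans hle)
  · exact map_colon_eq_of_isLocalization 𝔫.primeCompl _ _ (IsNoetherian.noetherian _)
end

section
/- Let (R, 𝔪) be a Cohen–Macaulay Noetherian local ring, let 𝔞 = (a_1, …, a_s) ⊆ I = (f_1, …, f_r) be ideals of R, and suppose J = 𝔞 :_R I is an s-residual intersection of I (i.e., J is a proper ideal with ht(J) ≥ s) with s ≤ ht(I) + 1. Choose c_{ij} ∈ R with a_j = Σ_{i=1}^r c_{ij} f_i, let S = R[U_{ij} : 1 ≤ i ≤ r, 1 ≤ j ≤ s] be the polynomial ring over R in rs indeterminates, set a'_j = Σ_{i=1}^r U_{ij} f_i, R(s, f) = (a'_1, …, a'_s) :_S IS, and let x denote the sequence U_{11} − c_{11}, …, U_{rs} − c_{rs} in S. Then for every maximal ideal 𝔫 of S containing R(s, f) + (x), the sequence x is a regular sequence both on the localization S_𝔫 and on S_𝔫/R(s, f)S_𝔫. -/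
open MvPolynomial

/-- `x` is a nonzerodivisor modulo the ideal `𝔠`. -/
def RegularMod {B : Type*} [CommRing B] (𝔠 : Ideal B) (x : B) : Prop :=
  ∀ b, x * b ∈ 𝔠 → b ∈ 𝔠

/-- The list `l` is a weakly regular sequence on `B ⧸ 𝔠`. -/
def WeaklyRegularMod {B : Type*} [CommRing B] : Ideal B → List B → Prop
  | _, [] => True
  | 𝔠, x :: l => RegularMod 𝔠 x ∧ WeaklyRegularMod (𝔠 ⊔ Ideal.span {x}) l

section Exchange

variable {B : Type*} [CommRing B]

lemma RegularMod.congr {𝔠 : Ideal B} {x y : B} (hx : RegularMod 𝔠 x) (h : x - y ∈ 𝔠) :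
    RegularMod 𝔠 y := fun b hb => hx b <| by
  have := 𝔠.add_mem (𝔠.mul_mem_right b h) hb
  rwa [← add_mul, sub_add_cancel] at this

lemma Ideal.mem_sup_span_singleton_iff {𝔠 : Ideal B} {x b : B} :
    b ∈ 𝔠 ⊔ Ideal.span {x} ↔ ∃ e, b - x * e ∈ 𝔠 := by
  rw [Submodule.mem_sup]
  constructor
  · rintro ⟨c, hc, y, hy, rfl⟩
    obtain ⟨e, rfl⟩ := Ideal.mem_span_singleton'.1 hy
    exact ⟨e, by simpa [mul_comm] using hc⟩
  · rintro ⟨e, he⟩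
    exact ⟨_, he, x * e, Ideal.mem_span_singleton'.2 ⟨e, mul_comm _ _⟩, by ring⟩

variable [IsLocalRing B]

lemma le_of_le_sup_maximalIdeal_mul {M : Type*} [AddCommGroup M] [Module B M] [IsNoetherian B M]
    {N G : Submodule B M} {U : B} (hU : U ∈ IsLocalRing.maximalIdeal B)
    (h : ∀ m ∈ N, ∃ n ∈ N, m - U • n ∈ G) : N ≤ G := by
  refine Submodule.le_of_le_smul_of_le_jacobson_bot (I := Ideal.span {U})
    (IsNoetherian.noetherian N) ?_ ?_
  · rw [IsLocalRing.jacobson_eq_maximalIdeal _ bot_ne_top, Ideal.span_singleton_le_iff_mem]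
    exact hU
  · intro m hm
    obtain ⟨n, hn, hmn⟩ := h m hm
    exact Submodule.mem_sup.2 ⟨_, hmn, U • n,
      Submodule.smul_mem_smul (Ideal.mem_span_singleton_self U) hn, by abel⟩

variable [IsNoetherianRing B]

lemma RegularMod.exchange {𝔠 : Ideal B} {U x : B} (hU : U ∈ IsLocalRing.maximalIdeal B)
    (hreg : RegularMod 𝔠 U) (hx : RegularMod (𝔠 ⊔ Ideal.span {U}) x) :
    RegularMod 𝔠 x ∧ RegularMod (𝔠 ⊔ Ideal.span {x}) U := by
  constructor
  · let N : Ideal B := Submodule.comap (LinearMap.mulLeft B x) 𝔠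
    have : N ≤ 𝔠 := le_of_le_sup_maximalIdeal_mul hU fun b hb => by
      have hb' : x * b ∈ 𝔠 := hb
      obtain ⟨e, he⟩ := Ideal.mem_sup_span_singleton_iff.1 (hx b (Ideal.mem_sup_left hb'))
      refine ⟨e, hreg _ ?_, he⟩
      have := 𝔠.sub_mem hb' (𝔠.mul_mem_left x he)
      change U * (x * e) ∈ 𝔠
      convert this using 1
      ring
    exact fun b hb => this hb
  · intro b hb
    obtain ⟨e, he⟩ := Ideal.mem_sup_span_singleton_iff.1 hb
    have : x * e ∈ 𝔠 ⊔ Ideal.span {U} := by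
      refine Ideal.mem_sup_span_singleton_iff.2 ⟨b, ?_⟩
      rw [← neg_sub]
      exact 𝔠.neg_mem he
    obtain ⟨e', he'⟩ := Ideal.mem_sup_span_singleton_iff.1 (hx _ this)
    refine Ideal.mem_sup_span_singleton_iff.2 ⟨e', hreg _ ?_⟩
    have := 𝔠.add_mem he (𝔠.mul_mem_left x he')
    convert this using 1
    ring

lemma WeaklyRegularMod.exchange {𝔠 : Ideal B} {U : B} {l : List B}
    (hU : U ∈ IsLocalRing.maximalIdeal B) (hreg : RegularMod 𝔠 U)
    (hl : WeaklyRegularMod (𝔠 ⊔ Ideal.span {U}) l) :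
    WeaklyRegularMod 𝔠 l ∧ RegularMod (𝔠 ⊔ Ideal.ofList l) U := by
  induction l generalizing 𝔠 with
  | nil => exact ⟨trivial, by simpa using hreg⟩
  | cons x l ih =>
    obtain ⟨hx, hl⟩ := hl
    obtain ⟨h1, h2⟩ := hreg.exchange hU hx
    rw [sup_right_comm] at hl
    obtain ⟨h3, h4⟩ := ih h2 hl
    exact ⟨⟨h1, h3⟩, by rwa [Ideal.ofList_cons, ← sup_assoc]⟩

end Exchange

section Koszul

open Matrix

/-- Matrices `d i` (contractions) and `e i` (exterior multiplications) acting on a free module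
like on the exterior algebra of `B ^ r`, with the functional `top` reading off the coefficient of
the volume element `vol`. -/
structure ExteriorSystem (B : Type*) [CommRing B] (r : ℕ) (ι : Type*) [Fintype ι]
    [DecidableEq ι] where
  d : Fin r → Matrix ι ι B
  e : Fin r → Matrix ι ι B
  top : ι → B
  vol : ι → B
  d_sq : ∀ i, d i * d i = 0
  d_anticomm : ∀ i j, d i * d j + d j * d i = 0
  d_e : ∀ i j, d i * e j + e j * d i = if i = j then 1 else 0
  top_d : ∀ i, top ᵥ* d i = 0
  top_vol : top ⬝ᵥ vol = 1

namespace ExteriorSystem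

lemma exists_system (B : Type*) [CommRing B] (r : ℕ) :
    ∃ (ι : Type) (_ : Fintype ι) (_ : DecidableEq ι), Nonempty (ExteriorSystem B r ι) := by
  induction r with
  | zero => exact ⟨Unit, inferInstance, inferInstance, ⟨⟨Fin.elim0, Fin.elim0, fun _ => 1,
      fun _ => 1, fun i => i.elim0, fun i => i.elim0, fun i => i.elim0, fun i => i.elim0,
      by simp⟩⟩⟩
  | succ r ih =>
    obtain ⟨ι, _, _, ⟨k⟩⟩ := ih
    refine ⟨ι ⊕ ι, inferInstance, inferInstance, ⟨⟨
      Fin.cons (fromBlocks 0 1 0 0) fun i => fromBlocks (k.d i) 0 0 (-k.d i),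
      Fin.cons (fromBlocks 0 0 1 0) fun i => fromBlocks (k.e i) 0 0 (-k.e i),
      Sum.elim 0 k.top, Sum.elim 0 k.vol, ?_, ?_, ?_, ?_, ?_⟩⟩⟩
    · intro i
      cases i using Fin.cases <;> simp [fromBlocks_multiply, k.d_sq]
    · intro i j
      cases i using Fin.cases <;> cases j using Fin.cases <;>
        simp [fromBlocks_multiply, fromBlocks_add, k.d_anticomm]
    · intro i j
      cases i using Fin.cases <;> cases j using Fin.cases <;>
        simp [fromBlocks_multiply, fromBlocks_add, k.d_e, Fin.succ_ne_zero,
          (Fin.succ_ne_zero _).symm]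
      split_ifs <;> simp
    · intro i
      cases i using Fin.cases <;> simp [vecMul_fromBlocks, k.top_d, vecMul_neg]
    · simp [k.top_vol]

variable {B : Type*} [CommRing B] {r : ℕ} {ι : Type*} [Fintype ι] [DecidableEq ι]

/-- The base change of an exterior system along a ring homomorphism. -/
def map {A : Type*} [CommRing A] (k : ExteriorSystem A r ι) (φ : A →+* B) :
    ExteriorSystem B r ι where
  d i := φ.mapMatrix (k.d i)
  e i := φ.mapMatrix (k.e i)
  top i := φ (k.top i)
  vol i := φ (k.vol i)
  d_sq i := by rw [← map_mul, k.d_sq, map_zero]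
  d_anticomm i j := by rw [← map_mul, ← map_mul, ← map_add, k.d_anticomm, map_zero]
  d_e i j := by
    rw [← map_mul, ← map_mul, ← map_add, k.d_e]
    split_ifs <;> simp
  top_d i := by
    ext j
    have := congrFun (k.top_d i) j
    have h := RingHom.map_vecMul φ (k.d i) k.top j
    rw [this, Pi.zero_apply, map_zero] at h
    exact h.symm
  top_vol := by
    have := RingHom.map_dotProduct φ k.top k.vol
    rw [k.top_vol, map_one] at this
    exact this.symm

variable (k : ExteriorSystem B r ι) (f : Fin r → B)

/-- The Koszul differential on the elements `f`. -/
def diff : Matrix ι ι B := ∑ i, f i • k.d i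

lemma diff_mul_diff : k.diff f * k.diff f = 0 := by
  simp only [diff, Finset.sum_mul_sum, ← Finset.sum_product']
  refine Finset.sum_involution (fun p _ => (p.2, p.1)) ?_ ?_ (by simp) (by simp)
  · rintro ⟨i, j⟩ -
    simp only [smul_mul_smul_comm, mul_comm (f j) (f i), ← smul_add, k.d_anticomm, smul_zero]
  · rintro ⟨i, j⟩ - h heq
    obtain rfl : j = i := congrArg Prod.fst heq
    exact h (by simp [k.d_sq])

lemma diff_mul_e (i : Fin r) : k.diff f * k.e i + k.e i * k.diff f = f i • 1 := by
  simp only [diff, Finset.sum_mul, Finset.mul_sum, ← Finset.sum_add_distrib, smul_mul_assoc,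
    mul_smul_comm, ← smul_add, k.d_e]
  simp

lemma diff_mul_sum_e (c : Fin r → B) :
    k.diff f * (∑ i, c i • k.e i) + (∑ i, c i • k.e i) * k.diff f = (∑ i, c i * f i) • 1 := by
  simp only [Finset.sum_mul, Finset.mul_sum, ← Finset.sum_add_distrib, smul_mul_assoc,
    mul_smul_comm, ← smul_add, diff_mul_e, Finset.sum_smul, mul_smul]

lemma top_diff : k.top ᵥ* k.diff f = 0 := by
  simp [diff, vecMul_sum, vecMul_smul, k.top_d]

lemma mul_top_dotProduct (i : Fin r) (z : ι → B) :
    f i * (k.top ⬝ᵥ z) = k.top ⬝ᵥ (k.e i *ᵥ (k.diff f *ᵥ z)) := by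
  have h : f i • z = k.diff f *ᵥ (k.e i *ᵥ z) + k.e i *ᵥ (k.diff f *ᵥ z) := by
    rw [mulVec_mulVec, mulVec_mulVec, ← add_mulVec, diff_mul_e, smul_mulVec, one_mulVec]
  have := congrArg (k.top ⬝ᵥ ·) h
  simpa only [dotProduct_add, dotProduct_mulVec k.top (k.diff f), top_diff, zero_dotProduct,
    zero_add, dotProduct_smul, smul_eq_mul] using this

lemma mul_top_e_sub (i j : Fin r) (z : ι → B) :
    (k.top ⬝ᵥ (k.e i *ᵥ z)) * f j - (k.top ⬝ᵥ (k.e j *ᵥ z)) * f i =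
      -(k.top ⬝ᵥ (k.e j *ᵥ (k.e i *ᵥ (k.diff f *ᵥ z)))) := by
  have h : k.diff f *ᵥ (k.e i *ᵥ z) = f i • z - k.e i *ᵥ (k.diff f *ᵥ z) := by
    rw [eq_sub_iff_add_eq, mulVec_mulVec, mulVec_mulVec, ← add_mulVec, diff_mul_e, smul_mulVec,
      one_mulVec]
  rw [mul_comm, k.mul_top_dotProduct f j, h, mulVec_sub, mulVec_smul, dotProduct_sub,
    dotProduct_smul, smul_eq_mul]
  ring

lemma top_e_d_vol (i j : Fin r) :
    k.top ⬝ᵥ (k.e j *ᵥ (k.d i *ᵥ k.vol)) = if i = j then 1 else 0 := by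
  have h : k.e j *ᵥ (k.d i *ᵥ k.vol) =
      (if i = j then (1 : Matrix ι ι B) else 0) *ᵥ k.vol - k.d i *ᵥ (k.e j *ᵥ k.vol) := by
    rw [eq_sub_iff_add_eq, mulVec_mulVec, mulVec_mulVec, ← add_mulVec, add_comm, k.d_e]
  rw [h, dotProduct_sub, dotProduct_mulVec k.top (k.d i), top_d]
  split_ifs <;> simp [k.top_vol]

lemma diff_sum_d_vol_mem {𝔡 : Ideal B} {z : Fin r → B} (hz : ∀ i j, z i * f j - z j * f i ∈ 𝔡)
    (a : ι) : (k.diff f *ᵥ ∑ i, z i • (k.d i *ᵥ k.vol)) a ∈ 𝔡 := by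
  have h : k.diff f *ᵥ ∑ i, z i • (k.d i *ᵥ k.vol) =
      ∑ p : Fin r × Fin r, (f p.1 * z p.2) • ((k.d p.1 * k.d p.2) *ᵥ k.vol) := by
    simp only [diff, sum_mulVec, mulVec_sum, mulVec_smul, smul_mulVec, ← mulVec_mulVec,
      Finset.smul_sum, smul_smul, Fintype.sum_prod_type, mul_comm]
    exact Finset.sum_comm
  rw [h, ← Ideal.Quotient.eq_zero_iff_mem, Finset.sum_apply, map_sum]
  refine Finset.sum_involution (fun p _ => (p.2, p.1)) ?_ ?_ (by simp) (by simp)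
  · rintro ⟨i, j⟩ -
    have hd : k.d j * k.d i = -(k.d i * k.d j) := eq_neg_of_add_eq_zero_left (k.d_anticomm j i)
    rw [← map_add, Ideal.Quotient.eq_zero_iff_mem, hd]
    have := 𝔡.mul_mem_right (((k.d i * k.d j) *ᵥ k.vol) a) (hz j i)
    convert this using 1
    simp only [neg_mulVec, Pi.neg_apply, Pi.smul_apply, smul_eq_mul]
    ring
  · rintro ⟨i, j⟩ - h heq
    obtain rfl : j = i := congrArg Prod.fst heq
    exact h (by simp [k.d_sq])

end ExteriorSystem

end Koszul

section Lifting

open Matrix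

variable {B : Type*} [CommRing B] {ι : Type*} [Fintype ι]

/-- Every cycle of `D` modulo `𝔡` lifts to a cycle of `D` modulo `𝔠`. -/
def CyclesLift (D : Matrix ι ι B) (𝔠 𝔡 : Ideal B) : Prop :=
  ∀ z : ι → B, (∀ i, (D *ᵥ z) i ∈ 𝔡) → ∃ z', (∀ i, (D *ᵥ z') i ∈ 𝔠) ∧ ∀ i, z i - z' i ∈ 𝔡

lemma Ideal.mulVec_mem (𝔡 : Ideal B) (A : Matrix ι ι B) {z : ι → B} (hz : ∀ i, z i ∈ 𝔡) (i : ι) :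
    (A *ᵥ z) i ∈ 𝔡 :=
  𝔡.sum_mem fun j _ => 𝔡.mul_mem_left _ (hz j)

lemma Ideal.dotProduct_mem (𝔡 : Ideal B) (t : ι → B) {z : ι → B} (hz : ∀ i, z i ∈ 𝔡) :
    t ⬝ᵥ z ∈ 𝔡 :=
  𝔡.sum_mem fun j _ => 𝔡.mul_mem_left _ (hz j)

lemma CyclesLift.of_bot {D : Matrix ι ι B} {𝔠 𝔡 : Ideal B} (h : CyclesLift D ⊥ 𝔡) :
    CyclesLift D 𝔠 𝔡 := fun z hz => by
  obtain ⟨z', h1, h2⟩ := h z hz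
  exact ⟨z', fun i => bot_le (a := 𝔠) (h1 i), h2⟩

lemma CyclesLift.sup_span_singleton [DecidableEq ι] {D E : Matrix ι ι B} {𝔠 𝔡 : Ideal B} {x : B}
    (hD : D * D = 0) (hE : D * E + E * D = x • 1) (hx : RegularMod 𝔡 x)
    (h : CyclesLift D 𝔠 𝔡) :
    CyclesLift D (𝔠 ⊔ Ideal.span {x}) (𝔡 ⊔ Ideal.span {x}) := by
  intro z hz
  choose w hw using fun i => Ideal.mem_sup_span_singleton_iff.1 (hz i)
  have hDE (v : ι → B) : D *ᵥ (E *ᵥ v) = x • v - E *ᵥ (D *ᵥ v) := by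
    rw [eq_sub_iff_add_eq, mulVec_mulVec, mulVec_mulVec, ← add_mulVec, hE, smul_mulVec,
      one_mulVec]
  have hDw : ∀ i, (D *ᵥ w) i ∈ 𝔡 := fun i => hx _ <| by
    have := 𝔡.neg_mem (𝔡.mulVec_mem D (z := D *ᵥ z - x • w) hw i)
    rw [mulVec_sub, mulVec_mulVec, hD, zero_mulVec, zero_sub, mulVec_smul] at this
    simpa using this
  obtain ⟨w', hw', hww'⟩ := h w hDw
  obtain ⟨v, hv, hvz⟩ := h (z - E *ᵥ w) fun i => by
    have := 𝔡.add_mem (hw i) (𝔡.mulVec_mem E hDw i)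
    convert this using 1
    rw [mulVec_sub, hDE]
    simp only [Pi.sub_apply, Pi.smul_apply, smul_eq_mul]
    ring
  refine ⟨v + E *ᵥ w', fun i => ?_, fun i => ?_⟩
  · rw [mulVec_add, hDE]
    refine Ideal.add_mem _ (Ideal.mem_sup_left (hv i)) (Ideal.sub_mem _ ?_ ?_)
    · exact Ideal.mem_sup_right (Ideal.mul_mem_right _ _ (Ideal.mem_span_singleton_self x))
    · exact Ideal.mem_sup_left (𝔠.mulVec_mem E hw' i)
  · refine Ideal.mem_sup_left ?_
    have := 𝔡.add_mem (hvz i) (𝔡.mulVec_mem E (z := w - w') hww' i)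
    convert this using 1
    simp only [mulVec_sub, Pi.sub_apply, Pi.add_apply]
    ring

lemma CyclesLift.sup_ofList [DecidableEq ι] {D : Matrix ι ι B} (hD : D * D = 0) {l : List B}
    (hE : ∀ x ∈ l, ∃ E, D * E + E * D = x • 1) {𝔠 𝔡 : Ideal B} (hl : WeaklyRegularMod 𝔡 l)
    (h : CyclesLift D 𝔠 𝔡) :
    CyclesLift D (𝔠 ⊔ Ideal.ofList l) (𝔡 ⊔ Ideal.ofList l) := by
  induction l generalizing 𝔠 𝔡 with
  | nil => simpa using h
  | cons x l ih =>
    obtain ⟨E, hxE⟩ := hE x (by simp)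
    rw [Ideal.ofList_cons, ← sup_assoc, ← sup_assoc]
    exact ih (fun y hy => hE y (by simp [hy])) hl.2 (h.sup_span_singleton hD hxE hl.1)

/-- Lifting of cycles ascends from `B ⧸ (𝔠, U)` to `B ⧸ 𝔠`. -/
lemma CyclesLift.descend [IsNoetherianRing B] [IsLocalRing B] {D : Matrix ι ι B} {𝔠 : Ideal B}
    {U : B} (hU : U ∈ IsLocalRing.maximalIdeal B) (hreg : RegularMod 𝔠 U)
    (h : CyclesLift D ⊥ (𝔠 ⊔ Ideal.span {U})) : CyclesLift D ⊥ 𝔠 := by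
  let P : Submodule B (ι → B) := Submodule.pi Set.univ fun _ => 𝔠
  let N : Submodule B (ι → B) := P.comap D.mulVecLin
  have hN : N ≤ LinearMap.ker D.mulVecLin ⊔ P := le_of_le_sup_maximalIdeal_mul hU fun z hz => by
    have hz' : ∀ i, (D *ᵥ z) i ∈ 𝔠 := fun i => hz i trivial
    obtain ⟨z', hz'0, hzz'⟩ := h z fun i => Ideal.mem_sup_left (hz' i)
    choose w hw using fun i => Ideal.mem_sup_span_singleton_iff.1 (hzz' i)
    have hDz' : D *ᵥ z' = 0 := funext hz'0
    refine ⟨w, fun i _ => hreg _ ?_, Submodule.mem_sup.2 ⟨z', hDz', z - z' - U • w, fun i _ => hw i,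
      by abel⟩⟩
    have := 𝔠.sub_mem (hz' i) (𝔠.mulVec_mem D (z := z - z' - U • w) hw i)
    simpa [mulVec_sub, hDz', mulVec_smul] using this
  intro z hz
  obtain ⟨z', hz', p, hp, rfl⟩ := Submodule.mem_sup.1 (hN (x := z) fun i _ => hz i)
  exact ⟨z', fun i => congrFun hz' i, fun i => by simpa using hp i trivial⟩

end Lifting

section Specialization

open Matrix

variable {B : Type*} [CommRing B] {r : ℕ} {f : Fin r → B}

lemma mem_colon_range {𝔡 : Ideal B} {y : B} :
    y ∈ Submodule.colon 𝔡 (Set.range f) ↔ ∀ i, y * f i ∈ 𝔡 := by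
  simp [Submodule.mem_colon]

lemma mul_sum_mem {𝔡 : Ideal B} {y : B} (hy : ∀ i, y * f i ∈ 𝔡) (c : Fin r → B) :
    y * ∑ i, c i * f i ∈ 𝔡 := by
  rw [Finset.mul_sum]
  refine 𝔡.sum_mem fun i _ => ?_
  rw [mul_left_comm]
  exact 𝔡.mul_mem_left _ (hy i)

variable {ι : Type*} [Fintype ι] [DecidableEq ι] {k : ExteriorSystem B r ι}

lemma exists_colon_lift {𝔠 𝔡 : Ideal B} (h : CyclesLift (k.diff f) 𝔠 𝔡) {y : B}
    (hy : ∀ i, y * f i ∈ 𝔡) : ∃ y', (∀ i, y' * f i ∈ 𝔠) ∧ y - y' ∈ 𝔡 := by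
  obtain ⟨z, hz, hyz⟩ := h (y • k.vol) fun a => by
    rw [mulVec_smul, ExteriorSystem.diff, sum_mulVec, Pi.smul_apply, Finset.sum_apply, smul_eq_mul,
      Finset.mul_sum]
    refine 𝔡.sum_mem fun i _ => ?_
    rw [smul_mulVec, Pi.smul_apply, smul_eq_mul, ← mul_assoc]
    exact 𝔡.mul_mem_right _ (hy i)
  refine ⟨k.top ⬝ᵥ z, fun i => ?_, ?_⟩
  · rw [mul_comm, k.mul_top_dotProduct]
    exact 𝔠.dotProduct_mem _ (𝔠.mulVec_mem _ hz)
  · have := 𝔡.dotProduct_mem k.top (z := y • k.vol - z) hyz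
    simpa [dotProduct_sub, k.top_vol] using this

lemma exists_proportional_lift {𝔠 𝔡 : Ideal B} (h : CyclesLift (k.diff f) 𝔠 𝔡) {z : Fin r → B}
    (hz : ∀ i j, z i * f j - z j * f i ∈ 𝔡) :
    ∃ z' : Fin r → B, (∀ i j, z' i * f j - z' j * f i ∈ 𝔠) ∧ ∀ i, z i - z' i ∈ 𝔡 := by
  obtain ⟨w, hw, hzw⟩ := h (∑ i, z i • (k.d i *ᵥ k.vol)) (k.diff_sum_d_vol_mem f hz)
  refine ⟨fun i => k.top ⬝ᵥ (k.e i *ᵥ w), fun i j => ?_, fun i => ?_⟩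
  · rw [k.mul_top_e_sub]
    exact 𝔠.neg_mem (𝔠.dotProduct_mem _ (𝔠.mulVec_mem _ (𝔠.mulVec_mem _ hw)))
  · have := 𝔡.dotProduct_mem k.top (𝔡.mulVec_mem (k.e i)
      (z := (∑ i, z i • (k.d i *ᵥ k.vol)) - w) hzw)
    simpa [mulVec_sub, dotProduct_sub, mulVec_sum, dotProduct_sum, mulVec_smul, k.top_e_d_vol,
      -mulVec_mulVec] using this

/-- Specialization along `U` of a colon ideal whose lower ideal is generated by a regular
sequence. -/
lemma colon_specialize {𝔠 : Ideal B} {U : B} (hreg : RegularMod 𝔠 U)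
    (h : CyclesLift (k.diff f) 𝔠 (𝔠 ⊔ Ideal.span {U})) :
    RegularMod (Submodule.colon 𝔠 (Set.range f)) U ∧
      Submodule.colon 𝔠 (Set.range f) ⊔ Ideal.span {U} =
        Submodule.colon (𝔠 ⊔ Ideal.span {U}) (Set.range f) := by
  refine ⟨fun y hy => mem_colon_range.2 fun i => hreg _ ?_, le_antisymm (sup_le ?_ ?_) ?_⟩
  · rw [← mul_assoc]
    exact mem_colon_range.1 hy i
  · exact fun y hy => mem_colon_range.2 fun i => Ideal.mem_sup_left (mem_colon_range.1 hy i)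
  · rw [Ideal.span_singleton_le_iff_mem]
    exact mem_colon_range.2 fun i => Ideal.mem_sup_right
      (Ideal.mul_mem_right _ _ (Ideal.mem_span_singleton_self U))
  · intro y hy
    obtain ⟨y', hy', hyy'⟩ := exists_colon_lift h (mem_colon_range.1 hy)
    obtain ⟨e, he⟩ := Ideal.mem_sup_span_singleton_iff.1 hyy'
    refine Ideal.mem_sup_span_singleton_iff.2 ⟨e, mem_colon_range.2 fun i => ?_⟩
    have := 𝔠.add_mem (hy' i) (𝔠.mul_mem_right (f i) he)
    convert this using 1
    ring

/-- Specialization along `U` of a residual intersection by one more element than the grade. -/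
lemma colon_sup_specialize {𝔠 : Ideal B} {U t : B} (c : Fin r → B) (hreg : RegularMod 𝔠 U)
    (h : CyclesLift (k.diff f) 𝔠 (𝔠 ⊔ Ideal.span {U}))
    (ht : ∀ i, t * f i ∈ 𝔠 ⊔ Ideal.span {U} ⊔ Ideal.span {∑ i, c i * f i})
    (htreg : RegularMod (𝔠 ⊔ Ideal.span {U}) t) :
    RegularMod (Submodule.colon (𝔠 ⊔ Ideal.span {∑ i, c i * f i}) (Set.range f)) U ∧
      Submodule.colon (𝔠 ⊔ Ideal.span {∑ i, c i * f i}) (Set.range f) ⊔ Ideal.span {U} =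
        Submodule.colon (𝔠 ⊔ Ideal.span {U} ⊔ Ideal.span {∑ i, c i * f i}) (Set.range f) := by
  set a := ∑ i, c i * f i with ha
  set 𝔡 := 𝔠 ⊔ Ideal.span {U} with h𝔡
  choose q hq using fun i => Ideal.mem_sup_span_singleton_iff.1 (ht i)
  refine ⟨fun y hy => mem_colon_range.2 fun i => ?_, le_antisymm (sup_le ?_ ?_) ?_⟩
  · have hy' := mem_colon_range.1 hy i
    obtain ⟨b, hb⟩ := Ideal.mem_sup_span_singleton_iff.1 hy'
    have hba : b * a ∈ 𝔡 := Ideal.mem_sup_span_singleton_iff.2 ⟨y * f i, by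
      convert 𝔠.neg_mem hb using 1; ring⟩
    have hbf : ∀ j, b * f j ∈ 𝔡 := fun j => htreg _ <| by
      have := 𝔡.add_mem (𝔡.mul_mem_left b (hq j)) (𝔡.mul_mem_right (q j) hba)
      convert this using 1
      ring
    obtain ⟨b₀, hb₀, hbb₀⟩ := exists_colon_lift h hbf
    obtain ⟨b₁, hb₁⟩ := Ideal.mem_sup_span_singleton_iff.1 hbb₀
    refine Ideal.mem_sup_span_singleton_iff.2 ⟨b₁, hreg _ ?_⟩
    have := 𝔠.add_mem hb (𝔠.add_mem (𝔠.mul_mem_left a hb₁) (mul_sum_mem hb₀ c))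
    convert this using 1
    rw [ha]
    ring
  · exact fun y hy => mem_colon_range.2 fun i =>
      sup_le_sup_right (le_sup_left : 𝔠 ≤ 𝔡) _ (mem_colon_range.1 hy i)
  · rw [Ideal.span_singleton_le_iff_mem]
    exact mem_colon_range.2 fun i => Ideal.mem_sup_left <| Ideal.mem_sup_right
      (Ideal.mul_mem_right _ _ (Ideal.mem_span_singleton_self U))
  · intro y hy
    choose z hz using fun i => Ideal.mem_sup_span_singleton_iff.1 (mem_colon_range.1 hy i)
    have hzf : ∀ i j, z i * f j - z j * f i ∈ 𝔡 := fun i j => htreg _ <| htreg _ <| by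
      have := 𝔡.add_mem
        (𝔡.add_mem (𝔡.mul_mem_left (t * z i) (hq j)) (𝔡.mul_mem_left (-(t * z j)) (hq i)))
        (𝔡.add_mem (𝔡.add_mem (𝔡.mul_mem_left (-(t * q j)) (hz i))
          (𝔡.mul_mem_left (t * q i) (hz j)))
          (𝔡.add_mem (𝔡.mul_mem_left (y * q j) (hq i)) (𝔡.mul_mem_left (-(y * q i)) (hq j))))
      convert this using 1
      ring
    obtain ⟨z', hz', hzz'⟩ := exists_proportional_lift h hzf
    have hy' : ∀ j, (∑ i, c i * z' i) * f j - a * z' j ∈ 𝔠 := fun j => by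
      rw [ha, Finset.sum_mul, Finset.sum_mul, ← Finset.sum_sub_distrib]
      refine 𝔠.sum_mem fun i _ => ?_
      have := 𝔠.mul_mem_left (c i) (hz' i j)
      convert this using 1
      ring
    obtain ⟨y₀, hy₀, hyy₀⟩ := exists_colon_lift h (y := y - ∑ i, c i * z' i) fun j => by
      have := 𝔡.sub_mem (𝔡.add_mem (hz j) (𝔡.mul_mem_left a (hzz' j)))
        (Ideal.mem_sup_left (hy' j))
      convert this using 1
      ring
    obtain ⟨e, he⟩ := Ideal.mem_sup_span_singleton_iff.1 hyy₀
    refine Ideal.mem_sup_span_singleton_iff.2 ⟨e, mem_colon_range.2 fun j =>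
      Ideal.mem_sup_span_singleton_iff.2 ⟨z' j, ?_⟩⟩
    have := 𝔠.add_mem (𝔠.mul_mem_right (f j) he) (𝔠.add_mem (hy₀ j) (hy' j))
    convert this using 1
    ring

end Specialization

section Descent

lemma CyclesLift.sup_ofList_sup_span {B : Type*} [CommRing B] {r : ℕ} {f : Fin r → B}
    {ι : Type*} [Fintype ι] [DecidableEq ι] {k : ExteriorSystem B r ι} {𝔠 : Ideal B} {U : B}
    {l : List B} (hlf : ∀ x ∈ l, x ∈ Ideal.span (Set.range f))
    (hl : WeaklyRegularMod (𝔠 ⊔ Ideal.span {U}) l)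
    (h : CyclesLift (k.diff f) ⊥ (𝔠 ⊔ Ideal.span {U})) :
    CyclesLift (k.diff f) (𝔠 ⊔ Ideal.ofList l) (𝔠 ⊔ Ideal.ofList l ⊔ Ideal.span {U}) := by
  rw [sup_right_comm]
  refine CyclesLift.sup_ofList (k.diff_mul_diff f) (fun x hx => ?_) hl h.of_bot
  obtain ⟨c, rfl⟩ := Ideal.mem_span_range_iff_exists_fun.1 (hlf x hx)
  exact ⟨_, k.diff_mul_sum_e f c⟩

variable {B : Type*} [CommRing B] [IsNoetherianRing B] [IsLocalRing B] {r : ℕ} {f : Fin r → B}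
  {ι : Type*} [Fintype ι]

lemma CyclesLift.descend_ofList {D : Matrix ι ι B} {𝔠 : Ideal B} {us : List B}
    (hU : ∀ U ∈ us, U ∈ IsLocalRing.maximalIdeal B) (hreg : WeaklyRegularMod 𝔠 us)
    (h : CyclesLift D ⊥ (𝔠 ⊔ Ideal.ofList us)) : CyclesLift D ⊥ 𝔠 := by
  induction us generalizing 𝔠 with
  | nil => simpa using h
  | cons U us ih =>
    rw [Ideal.ofList_cons, ← sup_assoc] at h
    exact (ih (fun V hV => hU V (by simp [hV])) hreg.2 h).descend (hU U (by simp)) hreg.1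

lemma WeaklyRegularMod.descend_ofList {𝔠 : Ideal B} {us l : List B}
    (hU : ∀ U ∈ us, U ∈ IsLocalRing.maximalIdeal B) (hreg : WeaklyRegularMod 𝔠 us)
    (hl : WeaklyRegularMod (𝔠 ⊔ Ideal.ofList us) l) : WeaklyRegularMod 𝔠 l := by
  induction us generalizing 𝔠 with
  | nil => simpa using hl
  | cons U us ih =>
    rw [Ideal.ofList_cons, ← sup_assoc] at hl
    exact ((ih (fun V hV => hU V (by simp [hV])) hreg.2 hl).exchange (hU U (by simp)) hreg.1).1

variable [DecidableEq ι] {k : ExteriorSystem B r ι}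

/-- A sequence `us` that is regular modulo `𝔠` remains so modulo the colon ideal
`(𝔠, l) : f`, provided `f` and `l` behave well modulo `(𝔠, us)`. -/
lemma weaklyRegularMod_colon {𝔠 : Ideal B} {us l : List B}
    (hU : ∀ U ∈ us, U ∈ IsLocalRing.maximalIdeal B) (hreg : WeaklyRegularMod 𝔠 us)
    (hlf : ∀ x ∈ l, x ∈ Ideal.span (Set.range f))
    (hl : WeaklyRegularMod (𝔠 ⊔ Ideal.ofList us) l)
    (h : CyclesLift (k.diff f) ⊥ (𝔠 ⊔ Ideal.ofList us)) :
    WeaklyRegularMod (Submodule.colon (𝔠 ⊔ Ideal.ofList l) (Set.range f)) us := by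
  induction us generalizing 𝔠 with
  | nil => trivial
  | cons U us ih =>
    rw [Ideal.ofList_cons, ← sup_assoc] at h hl
    have hU' : ∀ V ∈ us, V ∈ IsLocalRing.maximalIdeal B := fun V hV => hU V (by simp [hV])
    have hl' := WeaklyRegularMod.descend_ofList hU' hreg.2 hl
    have := colon_specialize (hl'.exchange (hU U (by simp)) hreg.1).2
      ((CyclesLift.descend_ofList hU' hreg.2 h).sup_ofList_sup_span hlf hl')
    refine ⟨this.1, ?_⟩
    rw [this.2, sup_right_comm]
    exact ih hU' hreg.2 hl h

lemma exists_annihilator_descend {𝔠 : Ideal B} {us l : List B} {a : B}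
    (ha : a ∈ Ideal.span (Set.range f))
    (hU : ∀ U ∈ us, U ∈ IsLocalRing.maximalIdeal B) (hreg : WeaklyRegularMod 𝔠 us)
    (hlf : ∀ x ∈ l, x ∈ Ideal.span (Set.range f))
    (hl : WeaklyRegularMod (𝔠 ⊔ Ideal.ofList us) l)
    (h : CyclesLift (k.diff f) ⊥ (𝔠 ⊔ Ideal.ofList us))
    (ht : ∃ t, (∀ i, t * f i ∈ 𝔠 ⊔ Ideal.ofList us ⊔ Ideal.ofList l ⊔ Ideal.span {a}) ∧
      RegularMod (𝔠 ⊔ Ideal.ofList us ⊔ Ideal.ofList l) t) :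
    WeaklyRegularMod (Submodule.colon (𝔠 ⊔ Ideal.ofList l ⊔ Ideal.span {a}) (Set.range f)) us ∧
      ∃ t, (∀ i, t * f i ∈ 𝔠 ⊔ Ideal.ofList l ⊔ Ideal.span {a}) ∧
        RegularMod (𝔠 ⊔ Ideal.ofList l) t := by
  induction us generalizing 𝔠 with
  | nil => exact ⟨trivial, by simpa using ht⟩
  | cons U us ih =>
    rw [Ideal.ofList_cons, ← sup_assoc] at h hl ht
    have hU' : ∀ V ∈ us, V ∈ IsLocalRing.maximalIdeal B := fun V hV => hU V (by simp [hV])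
    obtain ⟨hws, t, ht, htreg⟩ := ih hU' hreg.2 hl h ht
    rw [sup_right_comm 𝔠] at hws ht htreg
    have hl' := WeaklyRegularMod.descend_ofList hU' hreg.2 hl
    have hUl := (hl'.exchange (hU U (by simp)) hreg.1).2
    obtain ⟨c, rfl⟩ := Ideal.mem_span_range_iff_exists_fun.1 ha
    have := colon_sup_specialize c hUl
      ((CyclesLift.descend_ofList hU' hreg.2 h).sup_ofList_sup_span hlf hl') ht htreg
    refine ⟨⟨this.1, ?_⟩, ?_⟩
    · rw [this.2]
      exact hws
    · have htc := mem_colon_range.2 ht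
      rw [← this.2] at htc
      obtain ⟨e, he⟩ := Ideal.mem_sup_span_singleton_iff.1 htc
      refine ⟨t - U * e, mem_colon_range.1 he, (RegularMod.exchange (hU U (by simp)) hUl
        (htreg.congr (Ideal.mem_sup_right ?_))).1⟩
      rw [sub_sub_cancel]
      exact Ideal.mul_mem_right _ _ (Ideal.mem_span_singleton_self U)

/-- The analogue of `weaklyRegularMod_colon` for one more generator `a`. -/
lemma weaklyRegularMod_colon_sup {𝔠 : Ideal B} {us l : List B} {a : B}
    (ha : a ∈ Ideal.span (Set.range f))
    (hU : ∀ U ∈ us, U ∈ IsLocalRing.maximalIdeal B) (hreg : WeaklyRegularMod 𝔠 us)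
    (hlf : ∀ x ∈ l, x ∈ Ideal.span (Set.range f))
    (hl : WeaklyRegularMod (𝔠 ⊔ Ideal.ofList us) l)
    (h : CyclesLift (k.diff f) ⊥ (𝔠 ⊔ Ideal.ofList us))
    (ht : ∃ t, (∀ i, t * f i ∈ 𝔠 ⊔ Ideal.ofList us ⊔ Ideal.ofList l ⊔ Ideal.span {a}) ∧
      RegularMod (𝔠 ⊔ Ideal.ofList us ⊔ Ideal.ofList l) t) :
    WeaklyRegularMod (Submodule.colon (𝔠 ⊔ Ideal.ofList l ⊔ Ideal.span {a}) (Set.range f)) us :=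
  (exists_annihilator_descend ha hU hreg hlf hl h ht).1

end Descent

section Retraction

open Matrix

variable {A B : Type*} [CommRing A] [CommRing B] {π : B →+* A}

lemma RegularMod.comap {𝔡 : Ideal A} {x : B}
    (hx : RegularMod 𝔡 (π x)) : RegularMod (𝔡.comap π) x := fun b hb =>
  hx (π b) (by simpa using hb)

lemma Ideal.comap_sup_span_singleton (hπ : Function.Surjective π) (𝔡 : Ideal A) (x : B) :
    (𝔡 ⊔ Ideal.span {π x}).comap π = 𝔡.comap π ⊔ Ideal.span {x} := by
  ext b
  rw [Ideal.mem_comap, Ideal.mem_sup_span_singleton_iff, Ideal.mem_sup_span_singleton_iff]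
  constructor
  · rintro ⟨e, he⟩
    obtain ⟨e, rfl⟩ := hπ e
    exact ⟨e, by simpa using he⟩
  · rintro ⟨e, he⟩
    exact ⟨π e, by simpa using he⟩

lemma Ideal.comap_sup_ofList (hπ : Function.Surjective π) (𝔡 : Ideal A) (l : List B) :
    (𝔡 ⊔ Ideal.ofList (l.map π)).comap π = 𝔡.comap π ⊔ Ideal.ofList l := by
  induction l generalizing 𝔡 with
  | nil => simp
  | cons x l ih =>
    rw [List.map_cons, Ideal.ofList_cons, Ideal.ofList_cons, ← sup_assoc, ← sup_assoc, ih,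
      Ideal.comap_sup_span_singleton hπ]

lemma WeaklyRegularMod.comap (hπ : Function.Surjective π) {𝔡 : Ideal A} {l : List B}
    (hl : WeaklyRegularMod 𝔡 (l.map π)) : WeaklyRegularMod (𝔡.comap π) l := by
  induction l generalizing 𝔡 with
  | nil => trivial
  | cons x l ih =>
    refine ⟨RegularMod.comap hl.1, ?_⟩
    rw [← Ideal.comap_sup_span_singleton hπ]
    exact ih hl.2

lemma CyclesLift.ker {ι : Type*} [Fintype ι] [DecidableEq ι] {φ : A →+* B}
    (hφ : ∀ a, π (φ a) = a) (D : Matrix ι ι A) :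
    CyclesLift (φ.mapMatrix D) ⊥ (RingHom.ker π) := by
  have hπD (z : ι → B) (i : ι) : π ((φ.mapMatrix D *ᵥ z) i) = (D *ᵥ (π ∘ z)) i := by
    simp [mulVec, dotProduct, hφ]
  intro z hz
  refine ⟨φ ∘ π ∘ z, fun i => ?_, fun i => ?_⟩
  · have : (φ.mapMatrix D *ᵥ (φ ∘ π ∘ z)) i = φ ((D *ᵥ (π ∘ z)) i) := by
      simp [mulVec, dotProduct]
    rw [this, ← hπD, (RingHom.mem_ker).1 (hz i), map_zero]
    exact zero_mem _
  · simp [RingHom.mem_ker, hφ]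

lemma ExteriorSystem.diff_map {r : ℕ} {ι : Type*} [Fintype ι] [DecidableEq ι]
    (k : ExteriorSystem A r ι) (φ : A →+* B) (f : Fin r → A) :
    (k.map φ).diff (φ ∘ f) = φ.mapMatrix (k.diff f) := by
  ext i j
  simp [ExteriorSystem.diff, ExteriorSystem.map, Matrix.sum_apply]

variable [IsNoetherianRing B] [IsLocalRing B] {r : ℕ} {f : Fin r → A} {φ : A →+* B}

/-- Deformation of a complete-intersection link along a retraction `π` of local rings whose
kernel is generated by the regular sequence `us`. -/
theorem weaklyRegularMod_colon_of_retraction (hφ : ∀ a, π (φ a) = a) {us l : List B}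
    (hU : ∀ U ∈ us, U ∈ IsLocalRing.maximalIdeal B) (hreg : WeaklyRegularMod ⊥ us)
    (hker : RingHom.ker π = Ideal.ofList us)
    (hlf : ∀ x ∈ l, x ∈ Ideal.span (Set.range (φ ∘ f)))
    (hl : WeaklyRegularMod ⊥ (l.map π)) :
    WeaklyRegularMod (Submodule.colon (Ideal.ofList l) (Set.range (φ ∘ f))) us := by
  obtain ⟨ι, _, _, ⟨k⟩⟩ := ExteriorSystem.exists_system A r
  have hπ : Function.Surjective π := fun a => ⟨φ a, hφ a⟩
  rw [← bot_sup_eq (Ideal.ofList l)]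
  refine weaklyRegularMod_colon (k := k.map φ) hU hreg hlf ?_ ?_
  · rw [bot_sup_eq, ← hker]
    exact WeaklyRegularMod.comap hπ hl
  · rw [bot_sup_eq, ← hker, k.diff_map]
    exact CyclesLift.ker hφ _

/-- Deformation of a residual intersection by one element `a` more than the length of a regular
sequence `l`. -/
theorem weaklyRegularMod_colon_sup_of_retraction (hφ : ∀ a, π (φ a) = a) {us l : List B} {a : B}
    (hU : ∀ U ∈ us, U ∈ IsLocalRing.maximalIdeal B) (hreg : WeaklyRegularMod ⊥ us)
    (hker : RingHom.ker π = Ideal.ofList us)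
    (ha : a ∈ Ideal.span (Set.range (φ ∘ f)))
    (hlf : ∀ x ∈ l, x ∈ Ideal.span (Set.range (φ ∘ f)))
    (hl : WeaklyRegularMod ⊥ (l.map π)) {t : A}
    (ht : ∀ i, t * f i ∈ Ideal.ofList (l.map π) ⊔ Ideal.span {π a})
    (htreg : RegularMod (Ideal.ofList (l.map π)) t) :
    WeaklyRegularMod (Submodule.colon (Ideal.ofList l ⊔ Ideal.span {a}) (Set.range (φ ∘ f)))
      us := by
  obtain ⟨ι, _, _, ⟨k⟩⟩ := ExteriorSystem.exists_system A r
  have hπ : Function.Surjective π := fun a => ⟨φ a, hφ a⟩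
  have hcomap := Ideal.comap_sup_ofList hπ ⊥ l
  rw [bot_sup_eq, ← RingHom.ker_eq_comap_bot] at hcomap
  rw [← bot_sup_eq (Ideal.ofList l)]
  refine weaklyRegularMod_colon_sup (k := k.map φ) ha hU hreg hlf ?_ ?_ ⟨φ t, fun i => ?_, ?_⟩
  · rw [bot_sup_eq, ← hker]
    exact WeaklyRegularMod.comap hπ hl
  · rw [bot_sup_eq, ← hker, k.diff_map]
    exact CyclesLift.ker hφ _
  · rw [bot_sup_eq, ← hker, ← hcomap, ← Ideal.comap_sup_span_singleton hπ, Ideal.mem_comap,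
      Function.comp_apply, map_mul, hφ, hφ]
    exact ht i
  · rw [bot_sup_eq, ← hker, ← hcomap]
    exact RegularMod.comap (by rwa [hφ])

end Retraction

section Sequence

open RingTheory.Sequence Pointwise

variable {B : Type*} [CommRing B]

lemma regularMod_iff_isSMulRegular {𝔠 : Ideal B} {x : B} :
    RegularMod 𝔠 x ↔ IsSMulRegular (B ⧸ 𝔠) x := by
  rw [isSMulRegular_iff_right_eq_zero_of_smul]
  constructor
  · intro h m hm
    obtain ⟨b, rfl⟩ := Ideal.Quotient.mk_surjective m
    exact Ideal.Quotient.eq_zero_iff_mem.2 (h b (Ideal.Quotient.eq_zero_iff_mem.1 hm))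
  · intro h b hb
    exact Ideal.Quotient.eq_zero_iff_mem.1 (h (Ideal.Quotient.mk 𝔠 b)
      (Ideal.Quotient.eq_zero_iff_mem.2 hb))

/-- Reducing `B ⧸ 𝔠` modulo `x` gives `B ⧸ (𝔠, x)`. -/
noncomputable def quotSMulTopQuotientEquiv (𝔠 : Ideal B) (x : B) :
    QuotSMulTop x (B ⧸ 𝔠) ≃ₗ[B] B ⧸ (𝔠 ⊔ Ideal.span {x}) :=
  (Submodule.quotEquivOfEq _ _ (by
    rw [← Submodule.ideal_span_singleton_smul, ← Submodule.range_mkQ 𝔠, LinearMap.range_eq_map,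
      ← Submodule.map_smul'', smul_eq_mul, Ideal.mul_top])).trans
    (Submodule.quotientQuotientEquivQuotientSup 𝔠 (Ideal.span {x}))

lemma weaklyRegularMod_iff_isWeaklyRegular {𝔠 : Ideal B} {l : List B} :
    WeaklyRegularMod 𝔠 l ↔ IsWeaklyRegular (B ⧸ 𝔠) l := by
  induction l generalizing 𝔠 with
  | nil => simp [WeaklyRegularMod]
  | cons x l ih =>
    rw [isWeaklyRegular_cons_iff, (quotSMulTopQuotientEquiv 𝔠 x).isWeaklyRegular_congr, ← ih,
      ← regularMod_iff_isSMulRegular]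
    rfl

lemma weaklyRegularMod_bot_iff {l : List B} :
    WeaklyRegularMod ⊥ l ↔ IsWeaklyRegular B l :=
  weaklyRegularMod_iff_isWeaklyRegular.trans
    ((Submodule.quotEquivOfEqBot ⊥ rfl).isWeaklyRegular_congr l)

end Sequence

section Depth

open RingTheory.Sequence IsLocalRing CategoryTheory Abelian

universe u

variable {R : Type u} [CommRing R] [IsLocalRing R]

lemma exists_isWeaklyRegular_iff [IsNoetherianRing R] (M : ModuleCat.{u} R) [Module.Finite R M]
    [Nontrivial M] (n : ℕ) :
    (∃ rs : List R, rs.length = n ∧ (∀ x ∈ rs, x ∈ maximalIdeal R) ∧ IsWeaklyRegular M rs) ↔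
      ∀ i < n, Subsingleton (Ext (ModuleCat.of R (Shrink.{u} (R ⧸ maximalIdeal R))) M i) := by
  rw [((ModuleCat.exists_isRegular_tfae (maximalIdeal R) n M (lt_top_iff_ne_top.2
    (Submodule.top_ne_ideal_smul_of_le_jacobson_annihilator (maximalIdeal_le_jacobson _)).symm)).out
    1 3 :)]
  exact exists_congr fun rs => and_congr_right fun _ => and_congr_right fun hrs =>
    (isRegular_iff_isWeaklyRegular_of_subset_maximalIdeal hrs).symm

/-- `R ⧸ 𝔠` admits a weakly regular sequence of length `n` in the maximal ideal. -/
def HasDepth (𝔠 : Ideal R) (n : ℕ) : Prop :=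
  ∃ rs : List R, rs.length = n ∧ (∀ x ∈ rs, x ∈ maximalIdeal R) ∧ WeaklyRegularMod 𝔠 rs

lemma HasDepth.sup_span_singleton [IsNoetherianRing R] {𝔠 : Ideal R} (h𝔠 : 𝔠 ≠ ⊤) {x : R}
    (hx : x ∈ maximalIdeal R) (hreg : RegularMod 𝔠 x) {n : ℕ} (h : HasDepth 𝔠 (n + 1)) :
    HasDepth (𝔠 ⊔ Ideal.span {x}) n := by
  have : Nontrivial (R ⧸ 𝔠) := Ideal.Quotient.nontrivial_iff.2 h𝔠
  have : Nontrivial (QuotSMulTop x (R ⧸ 𝔠)) := nontrivial_quotSMulTop_of_mem_maximalIdeal _ hx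
  rw [regularMod_iff_isSMulRegular] at hreg
  simp only [HasDepth, weaklyRegularMod_iff_isWeaklyRegular] at h ⊢
  simp only [← (quotSMulTopQuotientEquiv 𝔠 x).isWeaklyRegular_congr]
  have h := (exists_isWeaklyRegular_iff (ModuleCat.of R (R ⧸ 𝔠)) _).1 h
  refine (exists_isWeaklyRegular_iff (ModuleCat.of R (QuotSMulTop x (R ⧸ 𝔠))) n).2 fun i hi => ?_
  have zero1 := AddCommGrpCat.isZero_of_iff_subsingleton.mpr (h i (by omega))
  have zero2 := AddCommGrpCat.isZero_of_iff_subsingleton.mpr (h (i + 1) (by omega))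
  exact AddCommGrpCat.subsingleton_of_isZero <| ShortComplex.Exact.isZero_of_both_zeros
    ((Ext.covariant_sequence_exact₃' _ (IsSMulRegular.smulShortComplex_shortExact
      (M := ModuleCat.of R (R ⧸ 𝔠)) hreg)) i (i + 1) rfl)
    (zero1.eq_zero_of_src _) (zero2.eq_zero_of_tgt _)

end Depth

section AssociatedPrime

open IsLocalRing

variable {R : Type*} [CommRing R] [IsNoetherianRing R] {𝔠 : Ideal R}

lemma isAssociatedPrime_quotient_iff {p : Ideal R} :
    IsAssociatedPrime p (R ⧸ 𝔠) ↔ p.IsPrime ∧ ∃ b, ∀ y, y ∈ p ↔ y * b ∈ 𝔠 := by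
  rw [isAssociatedPrime_iff, Ideal.Quotient.mk_surjective.exists]
  refine and_congr_right fun _ => exists_congr fun b => ?_
  rw [Ideal.ext_iff]
  refine forall_congr' fun y => iff_congr Iff.rfl ?_
  rw [Submodule.mem_colon_singleton, Submodule.mem_bot, ← Ideal.Quotient.eq_zero_iff_mem, map_mul]
  rfl

lemma exists_isAssociatedPrime_quotient {b : R} (hb : b ∉ 𝔠) :
    ∃ p : Ideal R, IsAssociatedPrime p (R ⧸ 𝔠) ∧ ∀ y, y * b ∈ 𝔠 → y ∈ p := by
  obtain ⟨p, hp, hpb⟩ := exists_le_isAssociatedPrime_of_isNoetherianRing R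
    (Ideal.Quotient.mk 𝔠 b) (mt Ideal.Quotient.eq_zero_iff_mem.1 hb)
  refine ⟨p, hp, fun y hy => hpb ?_⟩
  rw [Submodule.mem_colon_singleton, Submodule.mem_bot]
  exact (map_mul _ _ _).symm.trans (Ideal.Quotient.eq_zero_iff_mem.2 hy)

lemma regularMod_of_notMem_isAssociatedPrime {x : R}
    (hx : ∀ p : Ideal R, IsAssociatedPrime p (R ⧸ 𝔠) → x ∉ p) : RegularMod 𝔠 x := fun b hb => by
  by_contra h
  obtain ⟨p, hp, hpb⟩ := exists_isAssociatedPrime_quotient h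
  exact hx p hp (hpb x hb)

lemma IsAssociatedPrime.le_of_quotient {p : Ideal R} (hp : IsAssociatedPrime p (R ⧸ 𝔠)) :
    𝔠 ≤ p := by
  obtain ⟨_, b, hb⟩ := isAssociatedPrime_quotient_iff.1 hp
  exact fun y hy => (hb y).2 (𝔠.mul_mem_right b hy)

variable [IsLocalRing R]

lemma IsAssociatedPrime.exists_lt {p : Ideal R} (hp : IsAssociatedPrime p (R ⧸ 𝔠)) {x : R}
    (hx : x ∈ maximalIdeal R) (hreg : RegularMod 𝔠 x) :
    ∃ q : Ideal R, IsAssociatedPrime q (R ⧸ (𝔠 ⊔ Ideal.span {x})) ∧ p < q := by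
  obtain ⟨hprime, b, hb⟩ := isAssociatedPrime_quotient_iff.1 hp
  have hb𝔠 : b ∉ 𝔠 := fun h => hprime.one_notMem ((hb 1).2 (by simpa using h))
  obtain ⟨b', hb', hb'𝔠⟩ : ∃ b', (∀ y ∈ p, y * b' ∈ 𝔠) ∧ b' ∉ 𝔠 ⊔ Ideal.span {x} := by
    by_contra! h
    refine hb𝔠 (le_of_le_sup_maximalIdeal_mul (N := Submodule.colon 𝔠 (p : Set R)) hx
      (fun m hm => ?_) (x := b) ?_)
    · rw [Submodule.mem_colon] at hm
      obtain ⟨e, he⟩ := Ideal.mem_sup_span_singleton_iff.1 (h m fun y hy => by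
        rw [mul_comm]
        exact hm y hy)
      refine ⟨e, Submodule.mem_colon.2 fun y hy => hreg _ ?_, he⟩
      have := 𝔠.sub_mem (hm y hy) (𝔠.mul_mem_right y he)
      convert this using 1
      simp only [smul_eq_mul]
      ring
    · exact Submodule.mem_colon.2 fun y hy => by
        rw [smul_eq_mul, mul_comm]
        exact (hb y).1 hy
  obtain ⟨q, hq, hqb⟩ := exists_isAssociatedPrime_quotient hb'𝔠
  refine ⟨q, hq, lt_of_le_of_ne (fun y hy => hqb y (Ideal.mem_sup_left (hb' y hy))) ?_⟩
  rintro rfl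
  refine hb𝔠 (hreg b ((hb x).1 (hqb x ?_)))
  exact Ideal.mem_sup_right (Ideal.mul_mem_right _ _ (Ideal.mem_span_singleton_self x))

/-- The depth of `R ⧸ 𝔠` is at most the dimension of `R ⧸ p` for associated primes `p`. -/
lemma IsAssociatedPrime.le_coheight {p : PrimeSpectrum R}
    (hp : IsAssociatedPrime p.asIdeal (R ⧸ 𝔠)) {n : ℕ} (h : HasDepth 𝔠 n) :
    n ≤ Order.coheight p := by
  obtain ⟨rs, rfl, hrs, hreg⟩ := h
  induction rs generalizing 𝔠 p with
  | nil => simp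
  | cons x rs ih =>
    obtain ⟨q, hq, hpq⟩ := hp.exists_lt (hrs x (by simp)) hreg.1
    have hpq' : p < ⟨q, hq.isPrime⟩ := hpq
    have := ih (p := ⟨q, hq.isPrime⟩) hq (fun y hy => hrs y (by simp [hy])) hreg.2
    rw [List.length_cons, Nat.cast_add, Nat.cast_one]
    exact (add_le_add_left this 1).trans (Order.coheight_add_one_le hpq')

end AssociatedPrime

section GeneralPosition

open IsLocalRing

variable {R : Type*} [CommRing R] [IsLocalRing R] {M : Type*} [AddCommGroup M] [Module R M]

lemma exists_span_cons_eq {v : M} {L : List M} (hv : v ∈ Submodule.span R {x | x ∈ L})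
    (hvm : v ∉ maximalIdeal R • Submodule.span R {x | x ∈ L}) :
    ∃ L' : List M, L'.length + 1 = L.length ∧
      Submodule.span R {x | x ∈ v :: L'} = Submodule.span R {x | x ∈ L} := by
  have hcons (w : M) (L : List M) : {x | x ∈ w :: L} = insert w {x | x ∈ L} := by
    ext
    simp
  induction L generalizing v with
  | nil =>
    have : v = 0 := by simpa using hv
    exact absurd (this ▸ zero_mem _) hvm
  | cons w L ih =>
    rw [hcons] at hv hvm
    obtain ⟨t, u, hu, rfl⟩ := Submodule.mem_span_insert.1 hv
    by_cases ht : IsUnit t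
    · obtain ⟨t, rfl⟩ := ht
      refine ⟨L, by simp, ?_⟩
      rw [hcons, hcons]
      refine le_antisymm (Submodule.span_le.2 (Set.insert_subset hv ?_))
        (Submodule.span_le.2 (Set.insert_subset ?_ ?_))
      · exact (Set.subset_insert _ _).trans Submodule.subset_span
      · refine Submodule.mem_span_insert.2 ⟨↑t⁻¹, -((↑t⁻¹ : R) • u),
          Submodule.neg_mem _ (Submodule.smul_mem _ _ hu), ?_⟩
        simp [smul_smul]
      · exact (Set.subset_insert _ _).trans Submodule.subset_span
    · have htm : t ∈ maximalIdeal R := ht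
      have hle : Submodule.span R {x | x ∈ L} ≤ Submodule.span R (insert w {x | x ∈ L}) :=
        Submodule.span_mono (Set.subset_insert _ _)
      have hw : w ∈ Submodule.span R (insert w {x | x ∈ L}) :=
        Submodule.subset_span (Set.mem_insert _ _)
      obtain ⟨L', hlen, hspan⟩ := ih hu fun h => hvm
        (add_mem (Submodule.smul_mem_smul htm hw) (Submodule.smul_mono le_rfl hle h))
      refine ⟨w :: L', by simp [hlen], ?_⟩
      rw [hcons, hcons, hcons]
      rw [hcons] at hspan
      refine le_antisymm (Submodule.span_le.2 (Set.insert_subset hv (Set.insert_subset hw ?_)))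
        (Submodule.span_le.2 (Set.insert_subset ?_ ?_))
      · exact fun x hx => hle (hspan.le (Submodule.subset_span (Set.mem_insert_of_mem _ hx)))
      · exact Submodule.subset_span (by simp)
      · suffices hsub : Submodule.span R {x | x ∈ L} ≤
            Submodule.span R (insert (t • w + u) (insert w {x | x ∈ L'})) from
          fun x hx => hsub (Submodule.subset_span hx)
        rw [← hspan]
        refine Submodule.span_le.2 (Set.insert_subset ?_ ?_)
        · have h1 : t • w + u ∈ Submodule.span R (insert (t • w + u) (insert w {x | x ∈ L'})) :=
            Submodule.subset_span (Set.mem_insert _ _)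
          have h2 : w ∈ Submodule.span R (insert (t • w + u) (insert w {x | x ∈ L'})) :=
            Submodule.subset_span (by simp)
          simpa using sub_mem h1 (Submodule.smul_mem _ t h2)
        · exact ((Set.subset_insert _ _).trans (Set.subset_insert _ _)).trans
            Submodule.subset_span

variable [IsNoetherianRing R]

lemma exists_regularMod_span_cons_eq {𝔠 : Ideal R} (h𝔠 : 𝔠 ≠ ⊤) (e : M →ₗ[R] R) {L : List M}
    (h : ∀ p : Ideal R, IsAssociatedPrime p (R ⧸ 𝔠) → ∃ w ∈ L, e w ∉ p) :
    ∃ (v : M) (L' : List M), L'.length + 1 = L.length ∧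
      Submodule.span R {x | x ∈ v :: L'} = Submodule.span R {x | x ∈ L} ∧ RegularMod 𝔠 (e v) := by
  set W := Submodule.span R {x | x ∈ L} with hW
  set 𝔟 : Ideal R := W.map e with h𝔟
  have hnot : ∀ p : Ideal R, IsAssociatedPrime p (R ⧸ 𝔠) → ¬ 𝔟 ≤ p := fun p hp hle => by
    obtain ⟨w, hw, hwp⟩ := h p hp
    exact hwp (hle (Submodule.mem_map_of_mem (Submodule.subset_span hw)))
  have hm𝔟 : ¬ 𝔟 ≤ maximalIdeal R * 𝔟 := fun hle => by
    have : 𝔟 = ⊥ := Submodule.eq_bot_of_le_smul_of_le_jacobson_bot _ _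
      (IsNoetherian.noetherian _) hle (maximalIdeal_le_jacobson _)
    obtain ⟨p, hp, -⟩ := exists_isAssociatedPrime_quotient
      (b := 1) (mt (Ideal.eq_top_iff_one _).2 h𝔠)
    exact hnot p hp (this ▸ bot_le)
  obtain ⟨x, hx, hxn⟩ : ∃ x ∈ 𝔟, ∀ p ∈ insert (maximalIdeal R * 𝔟) (associatedPrimes R (R ⧸ 𝔠)),
      x ∉ p := by
    by_contra! hcon
    obtain ⟨p, hp, hle⟩ := (𝔟.subset_union_prime_finite
      ((associatedPrimes.finite R (R ⧸ 𝔠)).insert (maximalIdeal R * 𝔟)) (f := id)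
      (maximalIdeal R * 𝔟) (maximalIdeal R * 𝔟) fun p hp hne _ =>
        ((Set.mem_insert_iff.1 hp).resolve_left hne).1).1 fun x hx => by
          simpa using hcon x hx
    obtain rfl | hp := hp
    · exact hm𝔟 hle
    · exact hnot p hp hle
  obtain ⟨v, hv, rfl⟩ := hx
  obtain ⟨L', hlen, hspan⟩ := exists_span_cons_eq (v := v) hv fun hvm =>
    hxn _ (Set.mem_insert _ _) (by
      rw [h𝔟, ← smul_eq_mul, ← Submodule.map_smul'']
      exact Submodule.mem_map_of_mem hvm)
  exact ⟨v, L', hlen, hspan, regularMod_of_notMem_isAssociatedPrime fun p hp =>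
    hxn p (Set.mem_insert_of_mem _ hp)⟩

/-- General position: generators of an ideal of sufficiently large height may be chosen so that
the first `h` of them form a regular sequence. -/
theorem exists_weaklyRegularMod_span_eq (e : M →ₗ[R] R) {h n : ℕ} {𝔠 : Ideal R}
    (h𝔠 : 𝔠 ≤ maximalIdeal R) {L : List M} (hL : ∀ w ∈ L, e w ∈ maximalIdeal R)
    (hh : h ≤ L.length) (hdepth : HasDepth 𝔠 n)
    (hp : ∀ p : PrimeSpectrum R, 𝔠 ≤ p.asIdeal → (∀ w ∈ L, e w ∈ p.asIdeal) →
      Order.coheight p + h ≤ n) :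
    ∃ L₁ L₂ : List M, L₁.length = h ∧ (L₁ ++ L₂).length = L.length ∧
      Submodule.span R {x | x ∈ L₁ ++ L₂} = Submodule.span R {x | x ∈ L} ∧
      WeaklyRegularMod 𝔠 (L₁.map e) ∧ HasDepth (𝔠 ⊔ Ideal.ofList (L₁.map e)) (n - h) := by
  have hcons (w : M) (L : List M) : {x | x ∈ w :: L} = insert w {x | x ∈ L} := by
    ext
    simp
  induction h generalizing 𝔠 n L with
  | zero => exact ⟨[], L, by simp, by simp, by simp, trivial, by simpa using hdepth⟩
  | succ h ih =>
    have h𝔠' : 𝔠 ≠ ⊤ := fun h => (maximalIdeal.isMaximal R).ne_top (top_le_iff.1 (h ▸ h𝔠))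
    obtain ⟨n, rfl⟩ : ∃ k, n = k + 1 := by
      have := (le_add_self).trans (hp ⟨maximalIdeal R, inferInstance⟩ h𝔠 hL)
      have : h + 1 ≤ n := by exact_mod_cast this
      exact ⟨n - 1, by omega⟩
    obtain ⟨v, L', hlen, hspan, hreg⟩ := exists_regularMod_span_cons_eq h𝔠' e (L := L)
      fun p hpa => by
        by_contra! hLp
        have h1 := hp ⟨p, hpa.isPrime⟩ hpa.le_of_quotient hLp
        have h2 := IsAssociatedPrime.le_coheight (p := ⟨p, hpa.isPrime⟩) hpa hdepth
        have h3 := h1.trans h2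
        obtain ⟨k, hk⟩ := ENat.ne_top_iff_exists.1
          (ne_top_of_le_ne_top (ENat.natCast_ne_top (n + 1)) (le_self_add.trans h1))
        rw [← hk] at h3
        have : k + (h + 1) ≤ k := by exact_mod_cast h3
        omega
    have hmem {𝔮 : Ideal R} (hq : ∀ w ∈ v :: L', e w ∈ 𝔮) : ∀ w ∈ L, e w ∈ 𝔮 := by
      have : Submodule.span R {x | x ∈ L} ≤ Submodule.comap e 𝔮 :=
        hspan ▸ Submodule.span_le.2 hq
      exact fun w hw => this (Submodule.subset_span hw)
    have hmem' {𝔮 : Ideal R} (hq : ∀ w ∈ L, e w ∈ 𝔮) : ∀ w ∈ v :: L', e w ∈ 𝔮 := by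
      have : Submodule.span R {x | x ∈ v :: L'} ≤ Submodule.comap e 𝔮 :=
        hspan ▸ Submodule.span_le.2 hq
      exact fun w hw => this (Submodule.subset_span hw)
    have hLm := hmem' hL
    have hvm : e v ∈ maximalIdeal R := hLm v (by simp)
    obtain ⟨L₁, L₂, hlen₁, hlen₂, hspan', hwr, hd⟩ := ih
      (sup_le h𝔠 ((Ideal.span_singleton_le_iff_mem _).2 hvm)) (L := L')
      (fun w hw => hLm w (by simp [hw])) (by omega) (hdepth.sup_span_singleton h𝔠' hvm hreg)
      fun p hle hpL => by
        have := hp p (le_sup_left.trans hle) (hmem fun w hw => by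
          obtain rfl | hw := List.mem_cons.1 hw
          · exact (Ideal.span_singleton_le_iff_mem _).1 (le_sup_right.trans hle)
          · exact hpL w hw)
        rw [Nat.cast_add, Nat.cast_add, ← add_assoc] at this
        exact (ENat.add_le_add_iff_right (ENat.natCast_ne_top 1)).1 this
    refine ⟨v :: L₁, L₂, by simp [hlen₁], by simpa [← hlen] using hlen₂, ?_, ⟨hreg, hwr⟩, ?_⟩
    · rw [← hspan, List.cons_append, hcons, hcons, Submodule.span_insert, hspan',
        ← Submodule.span_insert]
    · rw [List.map_cons, Ideal.ofList_cons, ← sup_assoc, Nat.add_sub_add_right]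
      exact hd

end GeneralPosition

section CohenMacaulay

open IsLocalRing

variable {R : Type*} [CommRing R]

lemma le_height_of_mul_le {I J 𝔞 : Ideal R} (hIJ : I * J ≤ 𝔞) {h : ℕ∞} (hI : h ≤ idealHeight I)
    (hJ : h ≤ idealHeight J) {p : PrimeSpectrum R} (hp : 𝔞 ≤ p.asIdeal) : h ≤ Order.height p := by
  obtain hle | hle := p.2.mul_le.1 (hIJ.trans hp)
  · exact hI.trans (iInf₂_le p hle)
  · exact hJ.trans (iInf₂_le p hle)

variable [IsNoetherianRing R]

lemma exists_mem_regularMod {𝔠 J : Ideal R}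
    (h : ∀ p : Ideal R, IsAssociatedPrime p (R ⧸ 𝔠) → ¬ J ≤ p) : ∃ t ∈ J, RegularMod 𝔠 t := by
  by_contra! hcon
  obtain ⟨p, hp, hle⟩ := (J.subset_union_prime_finite
    (associatedPrimes.finite R (R ⧸ 𝔠)) (f := id) ⊥ ⊥ fun p hp _ _ => hp.1).1 fun x hx => by
      by_contra hxn
      exact hcon x hx (regularMod_of_notMem_isAssociatedPrime fun p hp hxp =>
        hxn (Set.mem_biUnion hp hxp))
  exact h p hp hle

variable [IsLocalRing R]

lemma IsCohenMacaulayLocalRing.exists_hasDepth (hCM : IsCohenMacaulayLocalRing R) :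
    ∃ d : ℕ, (∀ p : PrimeSpectrum R, Order.height p + Order.coheight p ≤ d) ∧
      HasDepth (⊥ : Ideal R) d := by
  have hdim := hCM
  rw [IsCohenMacaulayLocalRing] at hdim
  have hne : ringDepth R ≠ ⊤ := fun h => ringKrullDim_ne_top (R := R) (by rw [← hdim, h]; rfl)
  obtain ⟨d, hd⟩ := ENat.ne_top_iff_exists.1 hne
  refine ⟨d, fun p => ?_, ?_⟩
  · rw [ringKrullDim, Order.krullDim_eq_iSup_height_add_coheight_of_nonempty,
      WithBot.coe_inj] at hdim
    rw [hd, hdim]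
    exact le_iSup (fun a : PrimeSpectrum R => Order.height a + Order.coheight a) p
  · cases d with
    | zero => exact ⟨[], rfl, by simp, trivial⟩
    | succ d =>
      have hlt : (d : ℕ∞) < ringDepth R := by
        rw [← hd]
        exact_mod_cast d.lt_succ_self
      obtain ⟨rs, hrs⟩ := lt_iSup_iff.1 hlt
      obtain ⟨hmem, hrs⟩ := lt_iSup_iff.1 hrs
      obtain ⟨hreg, hrs⟩ := lt_iSup_iff.1 hrs
      have hle : (rs.length : ℕ∞) ≤ (d + 1 : ℕ) := by
        rw [hd]
        exact le_iSup₂_of_le rs hmem (le_iSup_of_le hreg le_rfl)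
      have h1 : d < rs.length := by exact_mod_cast hrs
      have h2 : rs.length ≤ d + 1 := by exact_mod_cast hle
      exact ⟨rs, by omega, hmem, weaklyRegularMod_bot_iff.2 hreg.toIsWeaklyRegular⟩

theorem IsCohenMacaulayLocalRing.exists_general_position (hCM : IsCohenMacaulayLocalRing R)
    {M : Type*} [AddCommGroup M] [Module R M] (e : M →ₗ[R] R) {h : ℕ} {L : List M}
    (hL : ∀ w ∈ L, e w ∈ maximalIdeal R) (hh : h ≤ L.length)
    (hp : ∀ p : PrimeSpectrum R, (∀ w ∈ L, e w ∈ p.asIdeal) → h ≤ Order.height p) :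
    ∃ L₁ L₂ : List M, L₁.length = h ∧ (L₁ ++ L₂).length = L.length ∧
      Submodule.span R {x | x ∈ L₁ ++ L₂} = Submodule.span R {x | x ∈ L} ∧
      WeaklyRegularMod ⊥ (L₁.map e) ∧
      ∀ J : Ideal R, h + 1 ≤ idealHeight J → ∃ t ∈ J, RegularMod (Ideal.ofList (L₁.map e)) t := by
  obtain ⟨d, hd, hdepth⟩ := hCM.exists_hasDepth
  obtain ⟨L₁, L₂, h1, h2, h3, h4, h5⟩ := exists_weaklyRegularMod_span_eq e bot_le hL hh hdepth
    fun p _ hpL => by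
      rw [add_comm]
      exact (add_le_add_left (hp p hpL) _).trans (hd p)
  rw [bot_sup_eq] at h5
  refine ⟨L₁, L₂, h1, h2, h3, h4, fun J hJ => exists_mem_regularMod fun p hpa hJp => ?_⟩
  have hq : (h : ℕ∞) + 1 ≤ Order.height (⟨p, hpa.isPrime⟩ : PrimeSpectrum R) :=
    hJ.trans (iInf₂_le (⟨p, hpa.isPrime⟩ : PrimeSpectrum R) hJp)
  have hc := IsAssociatedPrime.le_coheight (p := ⟨p, hpa.isPrime⟩) hpa h5
  have : h + 1 + (d - h) ≤ d := by exact_mod_cast (add_le_add hq hc).trans (hd _)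
  omega

end CohenMacaulay

section Deformation

open IsLocalRing

lemma Ideal.ofList_eq_span {A : Type*} [CommRing A] (l : List A) :
    Ideal.ofList l = Ideal.span {x | x ∈ l} := rfl

lemma Ideal.ofList_ofFn {A : Type*} [CommRing A] {s : ℕ} (a : Fin s → A) :
    Ideal.ofList (List.ofFn a) = Ideal.span (Set.range a) := by
  rw [Ideal.ofList_eq_span]
  congr 1
  ext
  simp [List.mem_ofFn]

lemma Ideal.ofList_eq_of_span_eq {R B : Type*} [CommRing R] [CommRing B] [Algebra R B]
    {l l' : List B} (h : Submodule.span R {x | x ∈ l} = Submodule.span R {x | x ∈ l'}) :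
    Ideal.ofList l = Ideal.ofList l' := by
  rw [Ideal.ofList_eq_span, Ideal.ofList_eq_span, Ideal.span, Ideal.span,
    ← Submodule.span_span_of_tower R, h, Submodule.span_span_of_tower]

variable {R : Type*} [CommRing R] [IsLocalRing R] [IsNoetherianRing R]
  {B : Type*} [CommRing B] [IsLocalRing B] [IsNoetherianRing B] [Algebra R B]

/-- Let `π : B → R` be a retraction of local rings whose kernel is generated by the regular
sequence `us`, and let `a` be a lift to `B` of generators of `𝔞 ⊆ I = (f)`, where `𝔞 : I` is a
residual intersection. Then `us` is a regular sequence modulo `a : f`. -/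
theorem weaklyRegularMod_colon_of_residual (hCM : IsCohenMacaulayLocalRing R) (π : B →ₐ[R] R)
    {us : List B} (hU : ∀ U ∈ us, U ∈ maximalIdeal B) (hreg : WeaklyRegularMod ⊥ us)
    (hker : RingHom.ker π = Ideal.ofList us) {r s : ℕ} (f : Fin r → R) (a : Fin s → B)
    (ha : ∀ j, a j ∈ Ideal.span (Set.range (algebraMap R B ∘ f)))
    (hJproper : Submodule.colon (Ideal.span (Set.range (π ∘ a))) (Set.range f) ≠ ⊤)
    (hJ : s ≤ idealHeight (Submodule.colon (Ideal.span (Set.range (π ∘ a))) (Set.range f)))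
    (hI : s ≤ idealHeight (Ideal.span (Set.range f)) + 1) :
    WeaklyRegularMod
      (Submodule.colon (Ideal.span (Set.range a)) (Set.range (algebraMap R B ∘ f))) us := by
  set 𝔞 := Ideal.span (Set.range (π ∘ a)) with h𝔞
  set J := Submodule.colon 𝔞 (Set.range f) with hJdef
  have hφ : ∀ x, (π : B →+* R) (algebraMap R B x) = x := fun x => π.commutes x
  have hπ𝔞 (j : Fin s) : π (a j) ∈ 𝔞 := Ideal.subset_span ⟨j, rfl⟩
  have h𝔞J : 𝔞 ≤ J := fun x hx => mem_colon_range.2 fun i => 𝔞.mul_mem_right _ hx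
  have hIJ : Ideal.span (Set.range f) * J ≤ 𝔞 := Ideal.mul_le.2 fun x hx y hy => by
    obtain ⟨c, rfl⟩ := Ideal.mem_span_range_iff_exists_fun.1 hx
    rw [mul_comm]
    exact mul_sum_mem (mem_colon_range.1 hy) c
  have hL : ∀ w ∈ List.ofFn a, π.toLinearMap w ∈ maximalIdeal R := fun w hw => by
    obtain ⟨j, rfl⟩ := List.mem_ofFn.1 hw
    exact le_maximalIdeal hJproper (h𝔞J (hπ𝔞 j))
  have hp {p : PrimeSpectrum R} (hpL : ∀ w ∈ List.ofFn a, π.toLinearMap w ∈ p.asIdeal) :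
      𝔞 ≤ p.asIdeal := Ideal.span_le.2 <| by
    rintro _ ⟨j, rfl⟩
    exact hpL _ (List.mem_ofFn.2 ⟨j, rfl⟩)
  have hspan {l : List B} (h : Submodule.span R {x | x ∈ l} =
      Submodule.span R {x | x ∈ List.ofFn a}) : Ideal.ofList l = Ideal.span (Set.range a) := by
    rw [Ideal.ofList_eq_of_span_eq h, Ideal.ofList_ofFn]
  have hspanf {l : List B} (h : Ideal.ofList l = Ideal.span (Set.range a)) :
      ∀ x ∈ l, x ∈ Ideal.span (Set.range (algebraMap R B ∘ f)) := fun x hx => by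
    have : x ∈ Ideal.span (Set.range a) := h ▸ Ideal.subset_span hx
    refine Ideal.span_le.2 ?_ this
    rintro _ ⟨j, rfl⟩
    exact ha j
  by_cases hsI : s ≤ idealHeight (Ideal.span (Set.range f))
  · obtain ⟨l, l', hl, hlen, hll', hwr, -⟩ := hCM.exists_general_position π.toLinearMap (h := s) hL
      (by simp) fun p hpL => le_height_of_mul_le hIJ hsI hJ (hp hpL)
    obtain rfl : l' = [] := List.length_eq_zero_iff.1 (by simpa [hl] using hlen)
    rw [List.append_nil] at hll'
    rw [← hspan hll']
    exact weaklyRegularMod_colon_of_retraction hφ hU hreg hker (hspanf (hspan hll')) hwr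
  · obtain ⟨h, rfl⟩ : ∃ h, s = h + 1 := Nat.exists_eq_succ_of_ne_zero fun h0 => hsI (by simp [h0])
    rw [Nat.cast_add, Nat.cast_one] at hI hJ
    have hI' := (ENat.add_le_add_iff_right (ENat.natCast_ne_top 1)).1 hI
    obtain ⟨l, l', hl, hlen, hll', hwr, ht⟩ := hCM.exists_general_position π.toLinearMap (h := h)
      hL (by simp) fun p hpL => le_height_of_mul_le hIJ hI' (le_self_add.trans hJ) (hp hpL)
    obtain ⟨b, rfl⟩ : ∃ b, l' = [b] := List.length_eq_one_iff.1 (by simpa [hl] using hlen)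
    obtain ⟨t, htJ, htreg⟩ := ht J hJ
    have hab := hspan hll'
    have hmem := hspanf hab
    have hab' : Ideal.ofList (l.map π) ⊔ Ideal.span {π b} = 𝔞 := by
      have := congrArg (Ideal.map (π : B →+* R)) hab
      rw [Ideal.map_ofList, Ideal.map_span (f := (π : B →+* R)) (Set.range a), ← Set.range_comp,
        List.map_append, Ideal.ofList_append] at this
      exact (by simp : _ = _).trans this
    rw [Ideal.ofList_append, Ideal.ofList_singleton] at hab
    rw [← hab]
    exact weaklyRegularMod_colon_sup_of_retraction hφ hU hreg hker (hmem b (by simp))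
      (fun x hx => hmem x (by simp [hx])) hwr
      (fun i => hab'.symm ▸ mem_colon_range.1 htJ i) htreg

end Deformation

section Localization

variable {R S : Type*} [CommRing R] [CommRing S] [Algebra R S]

lemma Ideal.map_colon_range_of_isLocalization (M : Submonoid S) (B : Type*) [CommRing B]
    [Algebra S B] [IsLocalization M B] (𝔠 : Ideal S) {r : ℕ} (F : Fin r → S) :
    Ideal.map (algebraMap S B) (Submodule.colon 𝔠 (Set.range F)) =
      Submodule.colon (𝔠.map (algebraMap S B)) (Set.range (algebraMap S B ∘ F)) := by
  refine le_antisymm (Ideal.map_le_iff_le_comap.2 fun x hx => mem_colon_range.2 fun i => ?_)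
    fun z hz => ?_
  · rw [Function.comp_apply, ← map_mul]
    exact Ideal.mem_map_of_mem _ (mem_colon_range.1 hx i)
  · obtain ⟨⟨x, y⟩, hxy⟩ := IsLocalization.surj M z
    have hx (i : Fin r) : ∃ m ∈ M, m * (x * F i) ∈ 𝔠 := by
      rw [← IsLocalization.algebraMap_mem_map_algebraMap_iff M B, map_mul, ← hxy, mul_right_comm]
      exact Ideal.mul_mem_right _ _ (mem_colon_range.1 hz i)
    choose m hm hmx using hx
    have hu : IsUnit (algebraMap S B (∏ i, m i) * algebraMap S B y) :=
      (IsLocalization.map_units B (⟨∏ i, m i, Submonoid.prod_mem M fun i _ => hm i⟩ : M)).mul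
        (IsLocalization.map_units B y)
    rw [← Ideal.mul_unit_mem_iff_mem _ hu, mul_left_comm, hxy, ← map_mul]
    refine Ideal.mem_map_of_mem _ (mem_colon_range.2 fun i => ?_)
    rw [← Finset.prod_erase_mul _ _ (Finset.mem_univ i), mul_assoc, mul_assoc]
    exact 𝔠.mul_mem_left _ (hmx i)

lemma exists_algHom_localization [IsLocalRing R] (ev : S →ₐ[R] R) (𝔫 : Ideal S)
    [h𝔫 : 𝔫.IsMaximal] (hev : RingHom.ker ev ≤ 𝔫) :
    ∃ π : Localization.AtPrime 𝔫 →ₐ[R] R, (∀ x, π (algebraMap S _ x) = ev x) ∧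
      RingHom.ker π = (RingHom.ker ev).map (algebraMap S (Localization.AtPrime 𝔫)) := by
  have hsurj : Function.Surjective ev := fun x => ⟨algebraMap R S x, ev.commutes x⟩
  have hcomap : (𝔫.map ev).comap ev = 𝔫 := by
    rw [Ideal.comap_map_of_surjective ev hsurj]
    exact sup_eq_left.2 hev
  have hne : 𝔫.map ev ≠ ⊤ := fun h => h𝔫.ne_top (by rw [← hcomap, h, Ideal.comap_top])
  have h𝔫eq : 𝔫 = (IsLocalRing.maximalIdeal R).comap ev :=
    h𝔫.eq_of_le (Ideal.comap_ne_top _ (Ideal.IsPrime.ne_top inferInstance))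
      (Ideal.map_le_iff_le_comap.1 (IsLocalRing.le_maximalIdeal hne))
  have hunit (y : 𝔫.primeCompl) : IsUnit (ev y) := by
    by_contra h
    refine y.2 ?_
    exact h𝔫eq.ge h
  refine ⟨IsLocalization.liftAlgHom (M := 𝔫.primeCompl) (f := ev) hunit, fun x => by simp, ?_⟩
  refine le_antisymm (fun z hz => ?_) (Ideal.map_le_iff_le_comap.2 fun x hx => ?_)
  · obtain ⟨⟨x, y⟩, hxy⟩ := IsLocalization.surj 𝔫.primeCompl z
    rw [← Ideal.mul_unit_mem_iff_mem _ (IsLocalization.map_units _ y), hxy]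
    refine Ideal.mem_map_of_mem _ ?_
    have := congrArg (IsLocalization.liftAlgHom (M := 𝔫.primeCompl) (f := ev) hunit) hxy
    rw [map_mul, RingHom.mem_ker.1 hz, zero_mul] at this
    simpa using this.symm
  · simpa using hx

end Localization

section Substitution

variable {R σ : Type*} [CommRing R]

lemma MvPolynomial.sub_mem_of_forall_X {K : Ideal (MvPolynomial σ R)}
    {θ : MvPolynomial σ R →ₐ[R] MvPolynomial σ R} (h : ∀ p, X p - θ (X p) ∈ K)
    (g : MvPolynomial σ R) : g - θ g ∈ K := by
  have : Ideal.Quotient.mkₐ R K = (Ideal.Quotient.mkₐ R K).comp θ :=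
    MvPolynomial.algHom_ext fun p => Ideal.Quotient.eq.2 (h p)
  exact Ideal.Quotient.eq.1 (DFunLike.congr_fun this g)

lemma MvPolynomial.ker_aeval_eq_span (c : σ → R) :
    RingHom.ker (aeval c : MvPolynomial σ R →ₐ[R] R) =
      Ideal.span (Set.range fun p => (X p : MvPolynomial σ R) - C (c p)) := by
  refine le_antisymm (fun g hg => ?_) (Ideal.span_le.2 ?_)
  · have := sub_mem_of_forall_X (K := Ideal.span (Set.range fun p => X p - C (c p)))
      (θ := (Algebra.ofId R _).comp (aeval c))
      (fun p => Ideal.subset_span ⟨p, by simp [Algebra.ofId_apply]⟩) g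
    rwa [AlgHom.comp_apply, RingHom.mem_ker.1 hg, map_zero, sub_zero] at this
  · rintro _ ⟨p, rfl⟩
    simp

lemma MvPolynomial.eq_zero_of_X_sub_C_mul (c : σ → R) {p : σ} {g : MvPolynomial σ R}
    (h : (X p - C (c p)) * g = 0) : g = 0 := by
  have hid : (aeval fun q => X q - C (c q) : MvPolynomial σ R →ₐ[R] _).comp
      (aeval fun q => X q + C (c q) : MvPolynomial σ R →ₐ[R] MvPolynomial σ R) = AlgHom.id R _ :=
    MvPolynomial.algHom_ext fun q => by simp
  have hX : X p * aeval (fun q => (X q + C (c q) : MvPolynomial σ R)) g = X p * 0 := by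
    have := congrArg (aeval fun q => (X q + C (c q) : MvPolynomial σ R)) h
    rwa [map_mul, map_sub, aeval_X, aeval_C, algebraMap_eq, add_sub_cancel_right, map_zero,
      ← mul_zero (X p)] at this
  rw [← AlgHom.id_apply (R := R) g, ← hid, AlgHom.comp_apply, X_mul_cancel_left_iff.1 hX, map_zero]

lemma MvPolynomial.weaklyRegularMod_X_sub_C (c : σ → R) (t l : List σ) (h : (t ++ l).Nodup) :
    WeaklyRegularMod (Ideal.ofList (t.map fun p => (X p : MvPolynomial σ R) - C (c p)))
      (l.map fun p => X p - C (c p)) := by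
  classical
  induction l generalizing t with
  | nil => trivial
  | cons p l ih =>
    refine ⟨fun b hb => ?_, ?_⟩
    · have hpt : p ∉ t := fun hp => (List.nodup_append.1 h).2.2 p hp p (by simp) rfl
      set K := Ideal.ofList (t.map fun p => (X p : MvPolynomial σ R) - C (c p))
      let θ : MvPolynomial σ R →ₐ[R] MvPolynomial σ R :=
        aeval fun q => if q ∈ t then C (c q) else X q
      have hK : K ≤ RingHom.ker θ := Ideal.span_le.2 fun x hx => by
        obtain ⟨q, hq, rfl⟩ := List.mem_map.1 hx
        simp [θ, hq]
      have hθ := sub_mem_of_forall_X (K := K) (θ := θ) (fun q => by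
        by_cases hq : q ∈ t
        · have : X q - C (c q) ∈ K := Ideal.subset_span (List.mem_map.2 ⟨q, hq, rfl⟩)
          simpa [θ, hq] using this
        · simp [θ, hq]) b
      have h0 : (X p - C (c p)) * θ b = 0 := by
        simpa [θ, hpt] using RingHom.mem_ker.1 (hK hb)
      rwa [eq_zero_of_X_sub_C_mul c h0, sub_zero] at hθ
    · have := ih (t ++ [p]) (by simpa using h)
      rwa [List.map_append, Ideal.ofList_append, List.map_singleton, Ideal.ofList_singleton] at this

end Substitution

/-- Let `(R, 𝔪)` be a Cohen–Macaulay Noetherian local ring,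
`𝔞 = (a₁, …, a_s) ⊆ I = (f₁, …, f_r)` with `a_j = Σᵢ c_{ij} fᵢ`, and suppose
`J = 𝔞 :_R I` is an `s`-residual intersection of `I` (proper with `ht J ≥ s`) with
`s ≤ ht I + 1`.  Let `S = R[U_{ij}]`, `a'_j = Σᵢ U_{ij} fᵢ`,
`R(s, f) = (a'₁, …, a'_s) :_S IS` and `x = U_{11} − c_{11}, …, U_{rs} − c_{rs}`.
Then for every maximal ideal `𝔫` of `S` containing `R(s, f) + (x)`, the sequence `x` is
a regular sequence both on `S_𝔫` and on `S_𝔫 / R(s, f)S_𝔫`. -/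
theorem statement9 {R : Type*} [CommRing R] [IsNoetherianRing R] [IsLocalRing R]
    (hCM : IsCohenMacaulayLocalRing R)
    {r s : ℕ} (f : Fin r → R) (c : Fin r → Fin s → R)
    (hJproper : Submodule.colon
        (Ideal.span (Set.range fun j : Fin s => ∑ i : Fin r, c i j * f i))
        (Ideal.span (Set.range f)) ≠ ⊤)
    (hJht : (s : ℕ∞) ≤ idealHeight (Submodule.colon
        (Ideal.span (Set.range fun j : Fin s => ∑ i : Fin r, c i j * f i))
        (Ideal.span (Set.range f))))
    (hs : (s : ℕ∞) ≤ idealHeight (Ideal.span (Set.range f)) + 1)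
    (𝔫 : Ideal (MvPolynomial (Fin r × Fin s) R)) (h𝔫 : 𝔫.IsMaximal)
    (h𝔫sub : genericResidual r s f ⊔
      Ideal.span (Set.range fun p : Fin r × Fin s =>
        (X p : MvPolynomial (Fin r × Fin s) R) - C (c p.1 p.2)) ≤ 𝔫) :
    haveI : 𝔫.IsPrime := h𝔫.isPrime
    (RingTheory.Sequence.IsRegular (Localization.AtPrime 𝔫)
        ((List.finRange r).flatMap fun i => (List.finRange s).map fun j =>
          algebraMap (MvPolynomial (Fin r × Fin s) R) (Localization.AtPrime 𝔫)
            ((X (i, j) : MvPolynomial (Fin r × Fin s) R) - C (c i j))) ∧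
      RingTheory.Sequence.IsRegular
        (Localization.AtPrime 𝔫 ⧸ (genericResidual r s f).map
          (algebraMap (MvPolynomial (Fin r × Fin s) R) (Localization.AtPrime 𝔫)))
        ((List.finRange r).flatMap fun i => (List.finRange s).map fun j =>
          algebraMap (MvPolynomial (Fin r × Fin s) R) (Localization.AtPrime 𝔫)
            ((X (i, j) : MvPolynomial (Fin r × Fin s) R) - C (c i j)))) := by
  have : 𝔫.IsPrime := h𝔫.isPrime
  let S := MvPolynomial (Fin r × Fin s) R
  let B := Localization.AtPrime 𝔫
  let t : List (Fin r × Fin s) := (List.finRange r).flatMap fun i => (List.finRange s).map (i, ·)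
  let x : List S := t.map fun p => X p - C (c p.1 p.2)
  let K : Ideal B := (genericResidual r s f).map (algebraMap S B)
  have ht : t.Nodup := (List.nodup_finRange r).product (List.nodup_finRange s)
  have hx : ((List.finRange r).flatMap fun i => (List.finRange s).map fun j =>
      algebraMap S B (X (i, j) - C (c i j))) = x.map (algebraMap S B) := by
    simp [x, t, List.map_flatMap, Function.comp_def]
  have hxspan : Ideal.ofList x = Ideal.span (Set.range fun p => X p - C (c p.1 p.2)) := by
    rw [Ideal.ofList_eq_span]
    congr 1
    ext
    simp [x, t]
  have hxn (y : S) (hy : y ∈ x) : y ∈ 𝔫 :=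
    (le_sup_right.trans h𝔫sub) (hxspan ▸ Ideal.subset_span hy)
  have hmem : ∀ U ∈ x.map (algebraMap S B), U ∈ IsLocalRing.maximalIdeal B := by
    simpa using fun y hy => (IsLocalization.AtPrime.to_map_mem_maximal_iff B 𝔫 y).2 (hxn y hy)
  have hK : K ≤ IsLocalRing.maximalIdeal B := Ideal.map_le_iff_le_comap.2 fun y hy =>
    (IsLocalization.AtPrime.to_map_mem_maximal_iff B 𝔫 y).2 (le_sup_left.trans h𝔫sub hy)
  have : Nontrivial (B ⧸ K) := Ideal.Quotient.nontrivial_iff.2 fun h =>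
    (Ideal.IsPrime.ne_top inferInstance) (top_le_iff.1 (h ▸ hK))
  have hregS : RingTheory.Sequence.IsWeaklyRegular S x := weaklyRegularMod_bot_iff.1 <| by
    simpa using weaklyRegularMod_X_sub_C (fun p => c p.1 p.2) [] t (by simpa using ht)
  have hregB := hregS.of_isLocalization B 𝔫.primeCompl
  obtain ⟨π, hπ, hker⟩ := exists_algHom_localization
    (aeval fun p : Fin r × Fin s => c p.1 p.2) 𝔫
    (by rw [ker_aeval_eq_span]; exact le_sup_right.trans h𝔫sub)
  rw [ker_aeval_eq_span, ← hxspan, Ideal.map_ofList] at hker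
  let a (j : Fin s) : S := ∑ i, X (i, j) * C (f i)
  have ha : (π ∘ algebraMap S B ∘ a) = fun j => ∑ i, c i j * f i := by
    funext j
    exact (hπ (a j)).trans (by simp [a])
  have hKcolon : K = Submodule.colon (Ideal.span (Set.range (algebraMap S B ∘ a)))
      (Set.range (algebraMap R B ∘ f)) := by
    have : algebraMap R B ∘ f = algebraMap S B ∘ (C ∘ f) := by
      funext i
      exact IsScalarTower.algebraMap_apply R S B (f i)
    rw [this, Set.range_comp, ← Ideal.map_span,
      ← Ideal.map_colon_range_of_isLocalization 𝔫.primeCompl]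
    simp only [K, genericResidual]
    rw [Ideal.map_span, Ideal.colon_span, ← Set.range_comp]
  rw [Ideal.colon_span] at hJproper hJht
  have hquot := weaklyRegularMod_colon_of_residual hCM π hmem (weaklyRegularMod_bot_iff.2 hregB)
    hker f (algebraMap S B ∘ a) (fun j => by
      simp only [Function.comp_apply, a, map_sum, map_mul]
      exact Ideal.sum_mem _ fun i _ => Ideal.mul_mem_left _ _ (Ideal.subset_span ⟨i, rfl⟩))
    (ha ▸ hJproper) (ha ▸ hJht) hs
  rw [← hKcolon, weaklyRegularMod_iff_isWeaklyRegular] at hquot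
  rw [hx]
  exact ⟨(IsLocalRing.isRegular_iff_isWeaklyRegular_of_subset_maximalIdeal hmem).2 hregB,
    (IsLocalRing.isRegular_iff_isWeaklyRegular_of_subset_maximalIdeal hmem).2 hquot⟩
end
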